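/- arXiv:2507.13763 — 4 statements merged into one kernel-verified Lean document; each statement's English description precedes it below -/
import Mathlib

section
/- Let Σ be a σ-algebra on Ω, ℙ an atomless probability measure on Σ, D a nonempty ℙ-invariant subset of the space B(Σ) of bounded Σ-measurable random variables, and φ : D → ℝ a ℙ-invariant functional. (i) If the lower supporting set L = {μ ∈ ca : ∀ X ∈ D, ∫ X dμ ≤ φ(X)} has a supremum in ca with respect to the setwise order, then there exists a constant a ∈ ℝ such that sup L = a·ℙ. (ii) If the upper supporting set U = {μ ∈ ca : ∀ X ∈ D, ∫ X dμ ≥ φ(X)} has an infimum in ca, then there exists a constant b ∈ ℝ such that inf U = b·ℙ. -/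
open MeasureTheory

/-- The integral of a bounded random variable with respect to a finite signed measure,
via the Jordan decomposition. -/
noncomputable def signedIntegral {Ω : Type*} [MeasurableSpace Ω]
    (μ : SignedMeasure Ω) (X : Ω → ℝ) : ℝ :=
  (∫ ω, X ω ∂μ.toJordanDecomposition.posPart) - ∫ ω, X ω ∂μ.toJordanDecomposition.negPart

section

open Filter Set
open scoped ENNReal

/-- Every event of positive measure contains a subevent of strictly smaller positive measure. -/
def Atomless {Ω : Type*} [MeasurableSpace Ω] (P : Measure Ω) : Prop :=
  ∀ A : Set Ω, MeasurableSet A → 0 < P A →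
    ∃ B : Set Ω, MeasurableSet B ∧ B ⊆ A ∧ 0 < P B ∧ P B < P A

namespace Atomless

variable {Ω : Type*} [MeasurableSpace Ω] {P : Measure Ω}

lemma restrict (h : Atomless P) {A : Set Ω} (hA : MeasurableSet A) :
    Atomless (P.restrict A) := by
  intro S hS hpos
  rw [Measure.restrict_apply hS] at hpos ⊢
  obtain ⟨B, hB, hBS, h1, h2⟩ := h _ (hS.inter hA) hpos
  refine ⟨B, hB, hBS.trans inter_subset_left, ?_⟩
  rw [Measure.restrict_apply hB, inter_eq_left.2 (hBS.trans inter_subset_right)]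
  exact ⟨h1, h2⟩

/-- In an almost-everywhere chain closed under countable unions, the measures that are at most `t`
have a maximum. -/
lemma exists_max_of_chain [IsFiniteMeasure P] {𝒞 : Set (Set Ω)}
    (hchain : ∀ c ∈ 𝒞, ∀ d ∈ 𝒞, c ≤ᵐ[P] d ∨ d ≤ᵐ[P] c)
    (hempty : ∅ ∈ 𝒞) (hunion : ∀ c : ℕ → Set Ω, (∀ n, c n ∈ 𝒞) → (⋃ n, c n) ∈ 𝒞) (t : ℝ≥0∞) :
    ∃ S ∈ 𝒞, P S ≤ t ∧ ∀ c ∈ 𝒞, P c ≤ t → P c ≤ P S := by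
  obtain ⟨u, -, hu, hmem⟩ := exists_seq_tendsto_sSup (S := P '' {c ∈ 𝒞 | P c ≤ t})
    ⟨P ∅, mem_image_of_mem _ ⟨hempty, by simp⟩⟩ (OrderTop.bddAbove _)
  choose c hc hcu using hmem
  have key : ∀ n, ∃ k, accumulate c n ≤ᵐ[P] c k := by
    intro n
    induction n with
    | zero => exact ⟨0, by rw [accumulate_zero_nat]; exact EventuallyLE.refl _ _⟩
    | succ n ih =>
      obtain ⟨k, hk⟩ := ih
      rw [accumulate_succ]
      rcases hchain _ (hc k).1 _ (hc (n + 1)).1 with h | h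
      · exact ⟨n + 1, by simpa using ae_le_set_union (hk.trans h) (EventuallyLE.refl _ (c (n + 1)))⟩
      · exact ⟨k, by simpa using ae_le_set_union hk h⟩
  have hle : P (⋃ n, c n) ≤ t := by
    rw [measure_iUnion_eq_iSup_accumulate]
    refine iSup_le fun n => ?_
    obtain ⟨k, hk⟩ := key n
    exact (measure_mono_ae hk).trans (hc k).2
  refine ⟨⋃ n, c n, hunion c fun n => (hc n).1, hle, fun d hd hdt => ?_⟩
  have hle_sup : P d ≤ sSup (P '' {c ∈ 𝒞 | P c ≤ t}) := le_sSup ⟨d, ⟨hd, hdt⟩, rfl⟩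
  refine hle_sup.trans (le_of_tendsto' hu fun n => ?_)
  rw [← hcu n]
  exact measure_mono (subset_iUnion c n)

/-- An atomless finite measure admits an almost-everywhere chain of measurable sets realizing
every possible value of the measure. -/
lemma exists_chain [IsFiniteMeasure P] (h : Atomless P) :
    ∃ C : ℝ≥0∞ → Set Ω, (∀ t, MeasurableSet (C t)) ∧ (∀ t ≤ P univ, P (C t) = t) ∧
      ∀ s t, C s ≤ᵐ[P] C t ∨ C t ≤ᵐ[P] C s := by
  let r : {s : Set Ω // MeasurableSet s} → {s : Set Ω // MeasurableSet s} → Prop :=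
    fun s t => s.1 ≤ᵐ[P] t.1
  have : Std.Refl r := ⟨fun s => EventuallyLE.refl _ _⟩
  have hmax := maxChain_spec (r := r)
  set 𝒞 : Set (Set Ω) := Subtype.val '' maxChain r
  have hmeas : ∀ c ∈ 𝒞, MeasurableSet c := by
    rintro _ ⟨c, -, rfl⟩
    exact c.2
  have hchain : ∀ c ∈ 𝒞, ∀ d ∈ 𝒞, c ≤ᵐ[P] d ∨ d ≤ᵐ[P] c := by
    rintro _ ⟨c, hc, rfl⟩ _ ⟨d, hd, rfl⟩
    exact hmax.1.total hc hd
  have hmem : ∀ s, MeasurableSet s → (∀ c ∈ 𝒞, s ≤ᵐ[P] c ∨ c ≤ᵐ[P] s) → s ∈ 𝒞 := by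
    intro s hs hcomp
    have hins : IsChain r (insert ⟨s, hs⟩ (maxChain r)) :=
      hmax.1.insert fun b hb _ => hcomp b.1 (mem_image_of_mem _ hb)
    refine ⟨⟨s, hs⟩, ?_, rfl⟩
    rw [hmax.2 hins (subset_insert _ _)]
    exact mem_insert _ _
  have hempty : ∅ ∈ 𝒞 := hmem ∅ .empty fun c _ => .inl (empty_subset c).eventuallyLE
  have huniv : univ ∈ 𝒞 := hmem univ .univ fun c _ => .inr (subset_univ c).eventuallyLE
  have hunion : ∀ c : ℕ → Set Ω, (∀ n, c n ∈ 𝒞) → (⋃ n, c n) ∈ 𝒞 := by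
    refine fun c hc => hmem _ (.iUnion fun n => hmeas _ (hc n)) fun d hd => ?_
    by_cases hex : ∃ n, d ≤ᵐ[P] c n
    · obtain ⟨n, hn⟩ := hex
      exact .inr (hn.trans (subset_iUnion c n).eventuallyLE)
    · push Not at hex
      have hcd : ∀ n, c n ≤ᵐ[P] d := fun n => (hchain _ (hc n) _ hd).resolve_right (hex n)
      refine .inl ?_
      simpa [iUnion_const] using Filter.EventuallyLE.countable_iUnion hcd
  have hinter : ∀ c : ℕ → Set Ω, (∀ n, c n ∈ 𝒞) → (⋂ n, c n) ∈ 𝒞 := by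
    refine fun c hc => hmem _ (.iInter fun n => hmeas _ (hc n)) fun d hd => ?_
    by_cases hex : ∃ n, c n ≤ᵐ[P] d
    · obtain ⟨n, hn⟩ := hex
      exact .inl ((iInter_subset c n).eventuallyLE.trans hn)
    · push Not at hex
      have hcd : ∀ n, d ≤ᵐ[P] c n := fun n => (hchain _ hd _ (hc n)).resolve_right (hex n)
      refine .inr ?_
      simpa [iInter_const] using Filter.EventuallyLE.countable_iInter hcd
  have hle : ∀ c ∈ 𝒞, ∀ d ∈ 𝒞, P c ≤ P d → c ≤ᵐ[P] d := by
    intro c hc d hd hcd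
    rcases hchain c hc d hd with h1 | h1
    · exact h1
    · exact (ae_eq_of_ae_subset_of_measure_ge h1 hcd (hmeas d hd).nullMeasurableSet
        (measure_ne_top _ _)).symm.le
  have hvalue : ∀ t ≤ P univ, ∃ c ∈ 𝒞, P c = t := by
    intro t ht
    obtain ⟨S, hS, hSt, hSmax⟩ := exists_max_of_chain hchain hempty hunion t
    obtain ⟨R, hR, hRt, hRmax⟩ := exists_max_of_chain (P := P) (𝒞 := compl '' 𝒞)
      (by
        rintro _ ⟨c, hc, rfl⟩ _ ⟨d, hd, rfl⟩
        exact (hchain d hd c hc).imp (fun h => h.compl) (fun h => h.compl))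
      ⟨univ, huniv, by simp⟩
      (by
        intro c hc
        refine ⟨⋂ n, (c n)ᶜ, hinter _ fun n => ?_, by simp [compl_iInter]⟩
        obtain ⟨d, hd, hdc⟩ := hc n
        rwa [← hdc, compl_compl])
      (P univ - t)
    obtain ⟨S', hS', rfl⟩ := hR
    have htop : t ≠ ∞ := ne_top_of_le_ne_top (measure_ne_top _ _) ht
    have hcompl : ∀ c ∈ 𝒞, P c + P cᶜ = P univ := fun c hc => measure_add_measure_compl (hmeas c hc)
    have hS't : t ≤ P S' := by
      have h1 := hcompl S' hS'
      by_contra! hlt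
      have : P S' + P S'ᶜ < t + (P univ - t) :=
        ENNReal.add_lt_add_of_lt_of_le (measure_ne_top _ _) hlt hRt
      rw [h1, add_tsub_cancel_of_le ht] at this
      exact lt_irrefl _ this
    have hS'min : ∀ c ∈ 𝒞, t ≤ P c → P S' ≤ P c := by
      intro c hc htc
      have h1 : P cᶜ ≤ P univ - t := by
        rw [measure_compl (hmeas c hc) (measure_ne_top _ _)]
        exact tsub_le_tsub_left htc _
      have h2 := hRmax cᶜ (mem_image_of_mem _ hc) h1
      have h3 := hcompl c hc
      rw [← hcompl S' hS'] at h3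
      by_contra! hlt
      exact absurd h3 (ENNReal.add_lt_add_of_lt_of_le (measure_ne_top _ _) hlt h2).ne
    by_contra! hne
    have hSlt : P S < t := lt_of_le_of_ne hSt (hne S hS)
    have hSS' : S ≤ᵐ[P] S' := hle S hS S' hS' (hSt.trans hS't)
    have hdiff : P S + P (S' \ S) = P S' := by
      rw [← measure_union disjoint_sdiff_right ((hmeas S' hS').diff (hmeas S hS)),
        union_sdiff_self]
      exact measure_congr (union_ae_eq_right_iff_ae_subset.2 hSS')
    have hpos : 0 < P (S' \ S) := by
      rw [pos_iff_ne_zero]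
      intro h0
      rw [h0, add_zero] at hdiff
      exact (hSlt.trans_le hS't).ne hdiff
    obtain ⟨E, hE, hES, hE0, hE1⟩ := h _ ((hmeas S' hS').diff (hmeas S hS)) hpos
    have hPG : P (S ∪ E) = P S + P E := measure_union (disjoint_sdiff_right.mono_right hES) hE
    have hG : S ∪ E ∈ 𝒞 := by
      refine hmem _ ((hmeas S hS).union hE) fun c hc => ?_
      rcases le_total (P c) t with hct | hct
      · exact .inr ((hle c hc S hS (hSmax c hc hct)).trans subset_union_left.eventuallyLE)
      · refine .inl (EventuallyLE.trans ?_ (hle S' hS' c hc (hS'min c hc hct)))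
        exact (union_subset_union_right S (hES.trans sdiff_subset)).eventuallyLE.trans
          (union_ae_eq_right_iff_ae_subset.2 hSS').le
    rcases le_total (P (S ∪ E)) t with hct | hct
    · refine absurd (hSmax _ hG hct) (not_le.2 ?_)
      rw [hPG]
      exact ENNReal.lt_add_right (measure_ne_top _ _) hE0.ne'
    · refine absurd (hS'min _ hG hct) (not_le.2 ?_)
      rw [hPG, ← hdiff]
      exact ENNReal.add_lt_add_left (measure_ne_top _ _) hE1
  have hvalue' : ∀ t, ∃ c ∈ 𝒞, t ≤ P univ → P c = t := fun t =>
    if ht : t ≤ P univ then (hvalue t ht).imp fun c hc => ⟨hc.1, fun _ => hc.2⟩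
    else ⟨∅, hempty, fun h' => absurd h' ht⟩
  choose C hC hPC using hvalue'
  exact ⟨C, fun t => hmeas _ (hC t), hPC, fun s t => hchain _ (hC s) _ (hC t)⟩

/-- The values of an atomless finite measure fill an interval. -/
lemma exists_subset_measure_eq [IsFiniteMeasure P] (h : Atomless P) {A : Set Ω}
    (hA : MeasurableSet A) {t : ℝ≥0∞} (ht : t ≤ P A) :
    ∃ B ⊆ A, MeasurableSet B ∧ P B = t := by
  obtain ⟨C, hC, hPC, -⟩ := (h.restrict hA).exists_chain
  refine ⟨C t ∩ A, inter_subset_right, (hC t).inter hA, ?_⟩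
  rw [← Measure.restrict_apply (hC t)]
  exact hPC t (by simpa using ht)

/-- An atomless probability space carries a uniformly distributed random variable. -/
lemma exists_uniform [IsProbabilityMeasure P] (h : Atomless P) :
    ∃ U : Ω → ℝ, Measurable U ∧ P.map U = volume.restrict (Ioc 0 1) := by
  classical
  obtain ⟨C, hC, hPC, hchain⟩ := h.exists_chain
  rw [measure_univ] at hPC
  have hlt : ∀ s t, s < t → t ≤ 1 → C s ≤ᵐ[P] C t := by
    intro s t hst ht
    refine (hchain s t).resolve_right fun h' => ?_
    have := measure_mono_ae h'
    rw [hPC t ht, hPC s (hst.le.trans ht)] at this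
    exact absurd this (not_le.2 hst)
  let g : ℚ → Ω → ℝ := fun q ω =>
    if 0 ≤ q ∧ q ≤ 1 ∧ ω ∈ C (ENNReal.ofReal q) then (q : ℝ) else 1
  have hg : ∀ q, Measurable (g q) := by
    intro q
    by_cases hq : 0 ≤ q ∧ q ≤ 1
    · simp only [g, hq, true_and]
      exact Measurable.ite (hC _) measurable_const measurable_const
    · have : g q = fun _ => 1 := by
        funext ω
        exact if_neg fun h' => hq ⟨h'.1, h'.2.1⟩
      rw [this]
      exact measurable_const
  have hg0 : ∀ q ω, 0 ≤ g q ω := by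
    intro q ω
    simp only [g]
    split_ifs with hq
    exacts [mod_cast hq.1, zero_le_one]
  have hbdd : ∀ ω, BddBelow (range fun q => g q ω) := fun ω =>
    ⟨0, by rintro _ ⟨q, rfl⟩; exact hg0 q ω⟩
  let U : Ω → ℝ := fun ω => ⨅ q, g q ω
  have hU : Measurable U := .iInf hg
  refine ⟨U, hU, ?_⟩
  have hU1 : ∀ ω, U ω ≤ 1 := by
    intro ω
    refine (ciInf_le (hbdd ω) 1).trans ?_
    simp [g]
  have hIio : ∀ t, 0 < t → t ≤ 1 → P (U ⁻¹' Iio t) = ENNReal.ofReal t := by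
    intro t ht ht1
    have hset : U ⁻¹' Iio t = ⋃ q : {q : ℚ // 0 ≤ q ∧ (q : ℝ) < t}, C (ENNReal.ofReal q.1) := by
      ext ω
      simp only [mem_preimage, mem_Iio, mem_iUnion, U]
      constructor
      · intro hlt'
        obtain ⟨q, hq⟩ := exists_lt_of_ciInf_lt hlt'
        simp only [g] at hq
        split_ifs at hq with hq'
        · exact ⟨⟨q, hq'.1, hq⟩, hq'.2.2⟩
        · exact absurd hq (not_lt.2 ht1)
      · rintro ⟨⟨q, hq0, hqt⟩, hq⟩
        refine (ciInf_le (hbdd ω) q).trans_lt ?_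
        have hq1 : q ≤ 1 := by exact_mod_cast hqt.le.trans ht1
        simp only [g]
        rwa [if_pos ⟨hq0, hq1, hq⟩]
    have ht1' : ENNReal.ofReal t ≤ 1 := ENNReal.ofReal_le_one.2 ht1
    rw [hset]
    apply le_antisymm
    · rw [← hPC _ ht1']
      refine measure_mono_ae ?_
      have := Filter.EventuallyLE.countable_iUnion (l := ae P)
        (s := fun q : {q : ℚ // 0 ≤ q ∧ (q : ℝ) < t} => C (ENNReal.ofReal q.1))
        (t := fun _ => C (ENNReal.ofReal t))
        fun q => hlt _ _ ((ENNReal.ofReal_lt_ofReal_iff ht).2 q.2.2) ht1'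
      have hn : Nonempty {q : ℚ // 0 ≤ q ∧ (q : ℝ) < t} := ⟨⟨0, le_rfl, by simpa using ht⟩⟩
      rwa [iUnion_const] at this
    · refine le_of_forall_lt_imp_le_of_dense fun x hx => ?_
      have hxtop : x ≠ ∞ := hx.ne_top
      have hx' : x.toReal < t := (ENNReal.lt_ofReal_iff_toReal_lt hxtop).1 hx
      obtain ⟨q, hxq, hqt⟩ := exists_rat_btwn hx'
      have hq0 : 0 ≤ q := by exact_mod_cast ENNReal.toReal_nonneg.trans hxq.le
      calc x ≤ ENNReal.ofReal q :=
          (ENNReal.le_ofReal_iff_toReal_le hxtop (by exact_mod_cast hq0)).2 hxq.le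
        _ = P (C (ENNReal.ofReal q)) :=
          (hPC _ (ENNReal.ofReal_le_one.2 (hqt.le.trans ht1))).symm
        _ ≤ _ := measure_mono (subset_iUnion_of_subset ⟨q, hq0, hqt⟩ subset_rfl)
  refine Measure.ext_of_Ici _ _ fun t => ?_
  rw [Measure.map_apply hU measurableSet_Ici, Measure.restrict_apply measurableSet_Ici]
  rcases le_or_gt t 0 with ht | ht
  · have h1 : U ⁻¹' Ici t = univ := eq_univ_of_forall fun ω =>
      ht.trans (le_ciInf fun q => hg0 q ω)
    have h2 : Ici t ∩ Ioc 0 1 = Ioc 0 1 := inter_eq_right.2 fun x hx => ht.trans hx.1.le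
    simp [h1, h2]
  · have h2 : Ici t ∩ Ioc 0 1 = Icc t 1 := by
      ext x
      simp only [mem_inter_iff, mem_Ici, mem_Ioc, mem_Icc]
      exact ⟨fun hx => ⟨hx.1, hx.2.2⟩, fun hx => ⟨hx.1, ht.trans_le hx.1, hx.2⟩⟩
    rw [h2, Real.volume_Icc]
    rcases le_or_gt t 1 with ht1 | ht1
    · rw [← compl_Iio, preimage_compl, prob_compl_eq_one_sub (hU measurableSet_Iio), hIio t ht ht1,
        ENNReal.ofReal_sub _ ht.le, ENNReal.ofReal_one]
    · have h1 : U ⁻¹' Ici t = ∅ := eq_empty_of_forall_notMem fun ω hω =>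
        absurd (hU1 ω) (not_le.2 (ht1.trans_le hω))
      rw [h1, measure_empty, ENNReal.ofReal_of_nonpos (by linarith)]

end Atomless

lemma Atomless.smul {Ω : Type*} [MeasurableSpace Ω] {P : Measure Ω} (h : Atomless P) {c : ℝ≥0∞}
    (hc : c ≠ ∞) : Atomless (c • P) := by
  intro A hA hpos
  simp only [Measure.smul_apply, smul_eq_mul] at hpos ⊢
  have hc0 : c ≠ 0 := fun h0 => by simp [h0] at hpos
  obtain ⟨B, hB, hBA, h1, h2⟩ := h A hA (pos_iff_ne_zero.2 (right_ne_zero_of_mul hpos.ne'))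
  exact ⟨B, hB, hBA, ENNReal.mul_pos hc0 h1.ne', ENNReal.mul_lt_mul_right hc0 hc h2⟩

/-- Every probability law on the line is the law of a function of a uniformly distributed point of
the circle. -/
lemma exists_map_unitAddCircle_eq (m : Measure ℝ) [IsProbabilityMeasure m] :
    ∃ q : UnitAddCircle → ℝ, Measurable q ∧ volume.map q = m := by
  obtain ⟨f, hf, hfm⟩ := Measure.exists_measurable_map_eq m
  have hproj : Measurable (projIcc (0 : ℝ) 1 zero_le_one) := continuous_projIcc.measurable
  have hvol : (volume.restrict (Ioc (0 : ℝ) 1)).map (projIcc (0 : ℝ) 1 zero_le_one) = volume := by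
    rw [restrict_Ioc_eq_restrict_Icc, ← map_comap_subtype_coe measurableSet_Icc,
      Measure.map_map hproj measurable_subtype_coe]
    have : projIcc (0 : ℝ) 1 zero_le_one ∘ Subtype.val = id := by
      funext x
      exact projIcc_val zero_le_one x
    rw [this, Measure.map_id]
    rfl
  have hequiv := AddCircle.measurePreserving_equivIoc (T := (1 : ℝ)) (a := 0)
  have hcirc : (volume : Measure UnitAddCircle).map
      (fun x => ((AddCircle.measurableEquivIoc (1 : ℝ) 0 x : Ioc (0 : ℝ) (0 + 1)) : ℝ)) =
      volume.restrict (Ioc (0 : ℝ) 1) := by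
    have h2 := congrArg (Measure.map Subtype.val) hequiv.map_eq
    rw [Measure.map_map measurable_subtype_coe hequiv.measurable,
      map_comap_subtype_coe measurableSet_Ioc] at h2
    exact h2.trans (by rw [zero_add])
  have hm : Measurable (fun x : UnitAddCircle =>
      ((AddCircle.measurableEquivIoc (1 : ℝ) 0 x : Ioc (0 : ℝ) (0 + 1)) : ℝ)) :=
    measurable_subtype_coe.comp (MeasurableEquiv.measurable _)
  refine ⟨_, hf.comp (hproj.comp hm), ?_⟩
  rw [← Measure.map_map hf (hproj.comp hm), ← Measure.map_map hproj hm, hcirc, hvol, hfm]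

/-- A bounded random variable on an event `B` can be rearranged over an equiprobable event `A` so
that its integral against a signed measure is at least that of an independent copy. -/
lemma Atomless.exists_rearrangement {Ω : Type*} [MeasurableSpace Ω] {P : Measure Ω}
    [IsProbabilityMeasure P] (h : Atomless P) {A B : Set Ω} (hA : MeasurableSet A)
    (hAB : P A = P B) {X : Ω → ℝ} (hX : Measurable X) {K : ℝ} (hXK : ∀ ω, |X ω| ≤ K)
    (ρ₁ ρ₂ : Measure Ω) [IsFiniteMeasure ρ₁] [IsFiniteMeasure ρ₂] :
    ∃ Y : Ω → ℝ, Measurable Y ∧ (∃ C, ∀ ω, |Y ω| ≤ C) ∧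
      (P.restrict A).map Y = (P.restrict B).map X ∧
      (ρ₁.real A - ρ₂.real A) / P.real A * ∫ ω in B, X ω ∂P ≤
        ∫ ω in A, Y ω ∂ρ₁ - ∫ ω in A, Y ω ∂ρ₂ := by
  rcases eq_or_ne (P A) 0 with hA0 | hA0
  · have h1 : P.restrict A = 0 := Measure.restrict_eq_zero.2 hA0
    have h2 : P.restrict B = 0 := Measure.restrict_eq_zero.2 (hAB ▸ hA0)
    exact ⟨0, measurable_zero, ⟨0, by simp⟩, by simp [h1, h2], by simp [h2]⟩
  have hAtop : P A ≠ ∞ := measure_ne_top _ _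
  have hPA : IsProbabilityMeasure ((P A)⁻¹ • P.restrict A) :=
    ⟨by simp [ENNReal.inv_mul_cancel hA0 hAtop]⟩
  have hPB : IsProbabilityMeasure ((P A)⁻¹ • P.restrict B) :=
    ⟨by simp [← hAB, ENNReal.inv_mul_cancel hA0 hAtop]⟩
  obtain ⟨U₀, hU₀, hU₀map⟩ := ((h.restrict hA).smul (ENNReal.inv_ne_top.2 hA0)).exists_uniform
  have hmk := UnitAddCircle.measurePreserving_mk 0
  rw [zero_add] at hmk
  let U : Ω → UnitAddCircle := fun ω => (U₀ ω : UnitAddCircle)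
  have hU : Measurable U := hmk.measurable.comp hU₀
  have hUmap : ((P A)⁻¹ • P.restrict A).map U = volume := by
    rw [← hmk.map_eq, ← hU₀map, Measure.map_map hmk.measurable hU₀]
    rfl
  have := Measure.isProbabilityMeasure_map (μ := (P A)⁻¹ • P.restrict B) hX.aemeasurable
  obtain ⟨q₀, hq₀, hq₀map⟩ :=
    exists_map_unitAddCircle_eq (((P A)⁻¹ • P.restrict B).map X)
  let clip : ℝ → ℝ := fun x => max (-K) (min K x)
  have hclip : Measurable clip := by fun_prop
  have hclipX : clip ∘ X = X := by
    funext ω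
    have := abs_le.1 (hXK ω)
    simp [clip, this.1, this.2]
  let q : UnitAddCircle → ℝ := clip ∘ q₀
  have hq : Measurable q := hclip.comp hq₀
  have hqmap : volume.map q = ((P A)⁻¹ • P.restrict B).map X := by
    rw [← Measure.map_map hclip hq₀, hq₀map, Measure.map_map hclip hX, hclipX]
  have hK : 0 ≤ K := by
    have : Nonempty Ω := nonempty_of_isProbabilityMeasure P
    exact (abs_nonneg _).trans (hXK (Classical.arbitrary Ω))
  have hqK : ∀ x, |q x| ≤ K := fun x =>
    abs_le.2 ⟨le_max_left _ _, max_le (by linarith) (min_le_left _ _)⟩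
  have hqint : ∫ x, q x = (P.real A)⁻¹ * ∫ ω in B, X ω ∂P := by
    have h1 : ∫ x, q x = ∫ y, y ∂(volume.map q) :=
      (integral_map hq.aemeasurable aestronglyMeasurable_id).symm
    have h2 : ∫ y, y ∂((P A)⁻¹ • P.restrict B).map X = ∫ ω, X ω ∂((P A)⁻¹ • P.restrict B) :=
      integral_map hX.aemeasurable aestronglyMeasurable_id
    rw [h1, hqmap, h2, integral_smul_measure, ENNReal.toReal_inv, smul_eq_mul]
    rfl
  have hjoint : Measurable fun p : UnitAddCircle × Ω => q (U p.2 + p.1) := by fun_prop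
  have hprod : ∀ ρ : Measure Ω, IsFiniteMeasure ρ →
      Integrable (fun p : UnitAddCircle × Ω => q (U p.2 + p.1)) (volume.prod (ρ.restrict A)) :=
    fun ρ _ => .of_bound hjoint.aestronglyMeasurable K (.of_forall fun p => hqK _)
  have hfubini : ∀ ρ : Measure Ω, IsFiniteMeasure ρ →
      ∫ θ, ∫ ω in A, q (U ω + θ) ∂ρ = ρ.real A * ∫ x, q x := by
    intro ρ _
    rw [integral_integral_swap (hprod ρ inferInstance)]
    simp [integral_add_left_eq_self q]
  have hint₁ := (hprod ρ₁ inferInstance).integral_prod_left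
  have hint₂ := (hprod ρ₂ inferInstance).integral_prod_left
  have : IsProbabilityMeasure (volume : Measure UnitAddCircle) := ⟨UnitAddCircle.measure_univ⟩
  obtain ⟨θ, hθ⟩ := exists_integral_le (hint₁.sub hint₂)
  refine ⟨fun ω => q (U ω + θ), by fun_prop, ⟨K, fun ω => hqK _⟩, ?_, ?_⟩
  · have hmap : ((P A)⁻¹ • P.restrict A).map (fun ω => q (U ω + θ)) =
        ((P A)⁻¹ • P.restrict B).map X := by
      have h1 : (fun ω => q (U ω + θ)) = (q ∘ fun x => x + θ) ∘ U := rfl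
      have hadd : Measurable fun x : UnitAddCircle => x + θ := by fun_prop
      rw [h1, ← Measure.map_map (hq.comp hadd) hU, hUmap, ← Measure.map_map hq hadd,
        map_add_right_eq_self, hqmap]
    rw [Measure.map_smul, Measure.map_smul] at hmap
    have := congrArg (fun m => P A • m) hmap
    simpa [smul_smul, ENNReal.mul_inv_cancel hA0 hAtop] using this
  · have h1 : ∫ x, ((fun x => ∫ ω in A, q (U ω + x) ∂ρ₁) - fun x => ∫ ω in A, q (U ω + x) ∂ρ₂) x =
        (ρ₁.real A - ρ₂.real A) / P.real A * ∫ ω in B, X ω ∂P := by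
      simp only [Pi.sub_apply]
      rw [integral_sub hint₁ hint₂, hfubini ρ₁ inferInstance, hfubini ρ₂ inferInstance, hqint]
      ring
    rw [← h1]
    exact hθ

section signedIntegral

variable {Ω : Type*} [MeasurableSpace Ω]

lemma integrable_of_bounded {m : Measure Ω} [IsFiniteMeasure m] {X : Ω → ℝ} (hX : Measurable X)
    (hb : ∃ C, ∀ ω, |X ω| ≤ C) : Integrable X m := by
  obtain ⟨C, hC⟩ := hb
  exact .of_bound hX.aestronglyMeasurable C (.of_forall hC)

/-- The signed integral may be computed from any representation as a difference of measures. -/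
lemma signedIntegral_sub (ρ₁ ρ₂ : Measure Ω) [IsFiniteMeasure ρ₁] [IsFiniteMeasure ρ₂]
    {X : Ω → ℝ} (hX : Measurable X) (hb : ∃ C, ∀ ω, |X ω| ≤ C) :
    signedIntegral (ρ₁.toSignedMeasure - ρ₂.toSignedMeasure) X =
      ∫ ω, X ω ∂ρ₁ - ∫ ω, X ω ∂ρ₂ := by
  set j := SignedMeasure.toJordanDecomposition (ρ₁.toSignedMeasure - ρ₂.toSignedMeasure) with hj
  have h1 : j.posPart.toSignedMeasure - j.negPart.toSignedMeasure =
      ρ₁.toSignedMeasure - ρ₂.toSignedMeasure :=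
    SignedMeasure.toSignedMeasure_toJordanDecomposition _
  have h2 : j.posPart + ρ₂ = ρ₁ + j.negPart := by
    rw [← Measure.toSignedMeasure_eq_toSignedMeasure_iff, Measure.toSignedMeasure_add,
      Measure.toSignedMeasure_add]
    rwa [sub_eq_sub_iff_add_eq_add] at h1
  have h3 := congrArg (fun m => ∫ ω, X ω ∂m) h2
  simp only [integral_add_measure (integrable_of_bounded hX hb) (integrable_of_bounded hX hb)] at h3
  rw [signedIntegral, ← hj]
  linarith

lemma signedIntegral_neg (μ : SignedMeasure Ω) (X : Ω → ℝ) :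
    signedIntegral (-μ) X = -signedIntegral μ X := by
  simp [signedIntegral, SignedMeasure.toJordanDecomposition_neg]

lemma signedIntegral_smul_add_smul (α β : ℝ) (ρ₁ ρ₂ : Measure Ω) [IsFiniteMeasure ρ₁]
    [IsFiniteMeasure ρ₂] {X : Ω → ℝ} (hX : Measurable X) (hb : ∃ C, ∀ ω, |X ω| ≤ C) :
    signedIntegral (α • ρ₁.toSignedMeasure + β • ρ₂.toSignedMeasure) X =
      α * ∫ ω, X ω ∂ρ₁ + β * ∫ ω, X ω ∂ρ₂ := by
  have hpos : ∀ x : ℝ, ((x.toNNReal : ℝ) - (-x).toNNReal) = x := fun x => by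
    simp [Real.coe_toNNReal', max_zero_sub_max_neg_zero_eq_self]
  have h1 : α • ρ₁.toSignedMeasure + β • ρ₂.toSignedMeasure =
      (α.toNNReal • ρ₁ + β.toNNReal • ρ₂).toSignedMeasure -
        ((-α).toNNReal • ρ₁ + (-β).toNNReal • ρ₂).toSignedMeasure := by
    ext A hA
    simp only [_root_.add_apply, _root_.sub_apply, _root_.smul_apply,
      Measure.toSignedMeasure_add, Measure.toSignedMeasure_smul, smul_eq_mul, NNReal.smul_def]
    linear_combination -(ρ₁.toSignedMeasure A) * hpos α - ρ₂.toSignedMeasure A * hpos β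
  rw [h1, signedIntegral_sub _ _ hX hb,
    integral_add_measure (integrable_of_bounded hX hb) (integrable_of_bounded hX hb),
    integral_add_measure (integrable_of_bounded hX hb) (integrable_of_bounded hX hb)]
  simp only [integral_smul_nnreal_measure, NNReal.smul_def, smul_eq_mul]
  linear_combination (∫ ω, X ω ∂ρ₁) * hpos α + (∫ ω, X ω ∂ρ₂) * hpos β

lemma map_eq_map_restrict_add (P : Measure Ω) {A : Set Ω} (hA : MeasurableSet A) {X : Ω → ℝ}
    (hX : Measurable X) :
    P.map X = (P.restrict A).map X + (P.restrict Aᶜ).map X := by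
  rw [← Measure.map_add _ _ hX, Measure.restrict_add_restrict_compl hA]

end signedIntegral

/-- The lower supporting set of `φ` on `D`. -/
def lowerSupport {Ω : Type*} [MeasurableSpace Ω] (D : Set (Ω → ℝ)) (φ : (Ω → ℝ) → ℝ) :
    Set (SignedMeasure Ω) :=
  {μ | ∀ X ∈ D, signedIntegral μ X ≤ φ X}

section lowerSupport

variable {Ω : Type*} [MeasurableSpace Ω] {P : Measure Ω}
  {D : Set (Ω → ℝ)} {φ : (Ω → ℝ) → ℝ}

/-- Signed measures in the lower supporting set of a law-invariant functional vanish on null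
sets. -/
lemma apply_eq_zero_of_mem_lowerSupport (hne : D.Nonempty)
    (hDmeas : ∀ X ∈ D, Measurable X) (hDbdd : ∀ X ∈ D, ∃ C : ℝ, ∀ ω, |X ω| ≤ C)
    (hDinv : ∀ X ∈ D, ∀ Y : Ω → ℝ, Measurable Y → (∃ C : ℝ, ∀ ω, |Y ω| ≤ C) →
      P.map X = P.map Y → Y ∈ D)
    (hφinv : ∀ X ∈ D, ∀ Y ∈ D, P.map X = P.map Y → φ X = φ Y)
    {μ : SignedMeasure Ω} (hμ : μ ∈ lowerSupport D φ) {N : Set Ω} (hN : MeasurableSet N)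
    (hPN : P N = 0) : μ N = 0 := by
  obtain ⟨X, hX⟩ := hne
  have hXm := hDmeas X hX
  have hXb := hDbdd X hX
  have key : ∀ c : ℝ, signedIntegral μ X + c * μ N ≤ φ X := by
    intro c
    have hI : Measurable (N.indicator fun _ => c) := measurable_const.indicator hN
    have hIb : ∃ C, ∀ ω, |N.indicator (fun _ => c) ω| ≤ C := by
      refine ⟨|c|, fun ω => ?_⟩
      by_cases hω : ω ∈ N <;> simp [hω]
    let Y : Ω → ℝ := fun ω => X ω + N.indicator (fun _ => c) ω
    have hYm : Measurable Y := hXm.add hI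
    have hYb : ∃ C, ∀ ω, |Y ω| ≤ C := by
      obtain ⟨C, hC⟩ := hXb
      obtain ⟨C', hC'⟩ := hIb
      exact ⟨C + C', fun ω => (abs_add_le _ _).trans (add_le_add (hC ω) (hC' ω))⟩
    have hXY : P.map X = P.map Y := by
      refine Measure.map_congr ?_
      filter_upwards [measure_eq_zero_iff_ae_notMem.1 hPN] with ω hω
      simp [Y, hω]
    have hY := hDinv X hX Y hYm hYb hXY
    have h1 := hμ Y hY
    rw [← hφinv X hX Y hY hXY] at h1
    refine le_trans (le_of_eq ?_) h1
    have hμN := SignedMeasure.apply_eq_posPart_real_sub_negPart_real μ hN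
    simp only [signedIntegral, Y]
    rw [integral_add (integrable_of_bounded hXm hXb) (integrable_of_bounded hI hIb),
      integral_add (integrable_of_bounded hXm hXb) (integrable_of_bounded hI hIb),
      integral_indicator_const _ hN, integral_indicator_const _ hN, hμN]
    simp only [smul_eq_mul]
    ring
  by_contra h0
  have := key ((φ X - signedIntegral μ X + 1) / μ N)
  rw [div_mul_cancel₀ _ h0] at this
  linarith

variable [IsProbabilityMeasure P]

/-- The lower supporting set of a law-invariant functional is stable under spreading the mass of an
event `A` uniformly over an equiprobable event `B`, and likewise for the complements. -/
lemma Atomless.average_mem_lowerSupport (h : Atomless P)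
    (hDmeas : ∀ X ∈ D, Measurable X) (hDbdd : ∀ X ∈ D, ∃ C : ℝ, ∀ ω, |X ω| ≤ C)
    (hDinv : ∀ X ∈ D, ∀ Y : Ω → ℝ, Measurable Y → (∃ C : ℝ, ∀ ω, |Y ω| ≤ C) →
      P.map X = P.map Y → Y ∈ D)
    (hφinv : ∀ X ∈ D, ∀ Y ∈ D, P.map X = P.map Y → φ X = φ Y)
    {μ : SignedMeasure Ω} (hμ : μ ∈ lowerSupport D φ) {A B : Set Ω} (hA : MeasurableSet A)
    (hB : MeasurableSet B) (hAB : P A = P B) :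
    (μ A / P.real A) • (P.restrict B).toSignedMeasure +
      (μ Aᶜ / P.real Aᶜ) • (P.restrict Bᶜ).toSignedMeasure ∈ lowerSupport D φ := by
  classical
  intro X hX
  have hXm := hDmeas X hX
  obtain ⟨K, hK⟩ := hDbdd X hX
  have hABc : P Aᶜ = P Bᶜ := by
    rw [prob_compl_eq_one_sub hA, prob_compl_eq_one_sub hB, hAB]
  obtain ⟨Y₁, hY₁, ⟨C₁, hC₁⟩, hmap₁, hle₁⟩ := h.exists_rearrangement hA hAB hXm hK
    μ.toJordanDecomposition.posPart μ.toJordanDecomposition.negPart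
  obtain ⟨Y₂, hY₂, ⟨C₂, hC₂⟩, hmap₂, hle₂⟩ := h.exists_rearrangement hA.compl hABc hXm hK
    μ.toJordanDecomposition.posPart μ.toJordanDecomposition.negPart
  rw [← SignedMeasure.apply_eq_posPart_real_sub_negPart_real μ hA] at hle₁
  rw [← SignedMeasure.apply_eq_posPart_real_sub_negPart_real μ hA.compl] at hle₂
  let Y : Ω → ℝ := A.piecewise Y₁ Y₂
  have hYm : Measurable Y := hY₁.piecewise hA hY₂
  have hYb : ∃ C, ∀ ω, |Y ω| ≤ C := by
    refine ⟨max C₁ C₂, fun ω => ?_⟩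
    by_cases hω : ω ∈ A
    · simpa [Y, hω] using .inl (hC₁ ω)
    · simpa [Y, hω] using .inr (hC₂ ω)
  have hXY : P.map X = P.map Y := by
    rw [map_eq_map_restrict_add P hB hXm, map_eq_map_restrict_add P hA hYm, ← hmap₁, ← hmap₂,
      Measure.map_congr (piecewise_ae_eq_restrict hA),
      Measure.map_congr (piecewise_ae_eq_restrict_compl hA)]
  have hY := hDinv X hX Y hYm hYb hXY
  have hμY := hμ Y hY
  rw [← hφinv X hX Y hY hXY] at hμY
  rw [signedIntegral_smul_add_smul _ _ _ _ hXm ⟨K, hK⟩]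
  have hsplit : ∀ m : Measure Ω, IsFiniteMeasure m →
      ∫ ω, Y ω ∂m = ∫ ω in A, Y₁ ω ∂m + ∫ ω in Aᶜ, Y₂ ω ∂m := fun m _ =>
    integral_piecewise hA (integrable_of_bounded hY₁ ⟨C₁, hC₁⟩).integrableOn
      (integrable_of_bounded hY₂ ⟨C₂, hC₂⟩).integrableOn
  rw [signedIntegral, hsplit _ inferInstance, hsplit _ inferInstance] at hμY
  linarith

/-- An upper bound of the lower supporting set of a law-invariant functional dominates the multiple
of `P` given by any average density of a member. -/
lemma Atomless.average_mul_le_of_mem_upperBounds (h : Atomless P)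
    (hDmeas : ∀ X ∈ D, Measurable X) (hDbdd : ∀ X ∈ D, ∃ C : ℝ, ∀ ω, |X ω| ≤ C)
    (hDinv : ∀ X ∈ D, ∀ Y : Ω → ℝ, Measurable Y → (∃ C : ℝ, ∀ ω, |Y ω| ≤ C) →
      P.map X = P.map Y → Y ∈ D)
    (hφinv : ∀ X ∈ D, ∀ Y ∈ D, P.map X = P.map Y → φ X = φ Y)
    {s : SignedMeasure Ω} (hs : s ∈ upperBounds (lowerSupport D φ))
    {μ : SignedMeasure Ω} (hμ : μ ∈ lowerSupport D φ) {A : Set Ω} (hA : MeasurableSet A)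
    (hPA : P A ≠ 0) {C : Set Ω} (hC : MeasurableSet C) :
    μ A / P.real A * P.real C ≤ s C := by
  have hsmall : ∀ C, MeasurableSet C → P C ≤ P A → μ A / P.real A * P.real C ≤ s C := by
    intro C hC hCA
    obtain ⟨E, hEC, hE, hPE⟩ := h.exists_subset_measure_eq hC.compl
      (t := P A - P C) (by
        rw [prob_compl_eq_one_sub hC]
        exact tsub_le_tsub_right prob_le_one _)
    have hB : P A = P (C ∪ E) := by
      rw [measure_union (disjoint_compl_right.mono_right hEC) hE, hPE, add_tsub_cancel_of_le hCA]
    have hle := hs (h.average_mem_lowerSupport hDmeas hDbdd hDinv hφinv hμ hA (hC.union hE) hB) C hC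
    refine le_trans (le_of_eq ?_) hle
    have h1 : C ∩ (C ∪ E) = C := inter_eq_left.2 subset_union_left
    have h2 : C ∩ (C ∪ E)ᶜ = ∅ := by
      rw [← disjoint_iff_inter_eq_empty]
      exact disjoint_compl_right.mono_left subset_union_left
    simp only [_root_.add_apply, _root_.smul_apply, Measure.toSignedMeasure_apply_measurable hC,
      measureReal_restrict_apply hC, h1, h2, measureReal_empty, smul_eq_mul, mul_zero, add_zero]
  have hpow : ∀ n : ℕ, ∀ C, MeasurableSet C → P C ≤ 2 ^ n * P A →
      μ A / P.real A * P.real C ≤ s C := by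
    intro n
    induction n with
    | zero => simpa using hsmall
    | succ n ih =>
      intro C hC hCA
      obtain ⟨E, hEC, hE, hPE⟩ := h.exists_subset_measure_eq hC (t := P C / 2) ENNReal.half_le_self
      have hEle : P C / 2 ≤ 2 ^ n * P A := by
        refine ENNReal.div_le_of_le_mul ?_
        rwa [pow_succ, mul_right_comm] at hCA
      have hdiff : P (C \ E) = P C / 2 := by
        rw [measure_sdiff hEC hE.nullMeasurableSet (measure_ne_top _ _), hPE,
          ENNReal.sub_half (measure_ne_top _ _)]
      have h1 := ih E hE (hPE.trans_le hEle)
      have h2 := ih (C \ E) (hC.diff hE) (hdiff.trans_le hEle)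
      have h3 : s C = s E + s (C \ E) := by
        rw [VectorMeasure.of_add_of_sdiff hE hC hEC]
      have h4 : P.real C = P.real E + P.real (C \ E) := by
        rw [← measureReal_union disjoint_sdiff_right (hC.diff hE), union_sdiff_cancel hEC]
      rw [h3, h4, mul_add]
      exact add_le_add h1 h2
  obtain ⟨n, hn⟩ : ∃ n : ℕ, P C ≤ 2 ^ n * P A := by
    obtain ⟨n, hn⟩ := ENNReal.exists_nat_mul_gt hPA (b := P C) (measure_ne_top _ _)
    refine ⟨n, hn.le.trans ?_⟩
    gcongr
    exact_mod_cast Nat.lt_two_pow_self.le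
  exact hpow n C hC hn

/-- If the lower supporting set of a law-invariant functional has a supremum, the supremum is a
multiple of `P`. -/
lemma Atomless.exists_eq_smul_of_isLUB_lowerSupport (h : Atomless P) (hne : D.Nonempty)
    (hDmeas : ∀ X ∈ D, Measurable X) (hDbdd : ∀ X ∈ D, ∃ C : ℝ, ∀ ω, |X ω| ≤ C)
    (hDinv : ∀ X ∈ D, ∀ Y : Ω → ℝ, Measurable Y → (∃ C : ℝ, ∀ ω, |Y ω| ≤ C) →
      P.map X = P.map Y → Y ∈ D)
    (hφinv : ∀ X ∈ D, ∀ Y ∈ D, P.map X = P.map Y → φ X = φ Y)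
    {s : SignedMeasure Ω} (hs : IsLUB (lowerSupport D φ) s) :
    ∃ a : ℝ, s = a • P.toSignedMeasure := by
  rcases (lowerSupport D φ).eq_empty_or_nonempty with hL | ⟨μ₀, hμ₀⟩
  · have h1 : s ≤ s - P.toSignedMeasure := hs.2 (by simp [hL])
    have h2 := h1 univ .univ
    simp only [_root_.sub_apply, Measure.toSignedMeasure_apply_measurable MeasurableSet.univ,
      probReal_univ] at h2
    linarith
  let R : Set ℝ := {r | ∃ μ ∈ lowerSupport D φ, ∃ A, MeasurableSet A ∧ P A ≠ 0 ∧ r = μ A / P.real A}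
  have hRne : R.Nonempty := ⟨_, μ₀, hμ₀, univ, .univ, by simp, rfl⟩
  have hR : ∀ r ∈ R, ∀ C, MeasurableSet C → r * P.real C ≤ s C := by
    rintro _ ⟨μ, hμ, A, hA, hPA, rfl⟩ C hC
    exact h.average_mul_le_of_mem_upperBounds hDmeas hDbdd hDinv hφinv hs.1 hμ hA hPA hC
  have hRbdd : BddAbove R := ⟨s univ, fun r hr => by simpa using hR r hr univ .univ⟩
  refine ⟨sSup R, le_antisymm (hs.2 fun μ hμ A hA => ?_) fun C hC => ?_⟩
  · simp only [_root_.smul_apply, Measure.toSignedMeasure_apply_measurable hA, smul_eq_mul]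
    rcases eq_or_ne (P A) 0 with hPA | hPA
    · rw [apply_eq_zero_of_mem_lowerSupport hne hDmeas hDbdd hDinv hφinv hμ hA hPA]
      simp [measureReal_def, hPA]
    · have hpos : 0 < P.real A := ENNReal.toReal_pos hPA (measure_ne_top _ _)
      rw [← div_le_iff₀ hpos]
      exact le_csSup hRbdd ⟨μ, hμ, A, hA, hPA, rfl⟩
  · simp only [_root_.smul_apply, Measure.toSignedMeasure_apply_measurable hC, smul_eq_mul]
    rcases measureReal_nonneg (μ := P) (s := C) |>.eq_or_lt with h0 | hpos
    · obtain ⟨r, hr⟩ := hRne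
      simpa [← h0] using hR r hr C hC
    · rw [← le_div_iff₀ hpos]
      exact csSup_le hRne fun r hr => (le_div_iff₀ hpos).2 (hR r hr C hC)

end lowerSupport

end

/-- Let `P` be an atomless probability measure, `D` a nonempty
`P`-invariant set of bounded measurable random variables and `φ : D → ℝ` `P`-invariant.
(i) If the lower supporting set `L = {μ ∈ ca | ∀ X ∈ D, ∫ X dμ ≤ φ X}` has a supremum in
`ca` (setwise order), it is a scalar multiple of `P`. (ii) If the upper supporting set has
an infimum in `ca`, it is a scalar multiple of `P`. -/
theorem stmt0 {Ω : Type*} [MeasurableSpace Ω] (P : Measure Ω) [IsProbabilityMeasure P]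
    (hatomless : ∀ A : Set Ω, MeasurableSet A → 0 < P A →
      ∃ B : Set Ω, MeasurableSet B ∧ B ⊆ A ∧ 0 < P B ∧ P B < P A)
    (D : Set (Ω → ℝ)) (hne : D.Nonempty)
    (hDmeas : ∀ X ∈ D, Measurable X) (hDbdd : ∀ X ∈ D, ∃ C : ℝ, ∀ ω, |X ω| ≤ C)
    (hDinv : ∀ X ∈ D, ∀ Y : Ω → ℝ, Measurable Y → (∃ C : ℝ, ∀ ω, |Y ω| ≤ C) →
      P.map X = P.map Y → Y ∈ D)
    (φ : (Ω → ℝ) → ℝ)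
    (hφinv : ∀ X ∈ D, ∀ Y ∈ D, P.map X = P.map Y → φ X = φ Y) :
    (∀ s : SignedMeasure Ω,
      IsLUB {μ : SignedMeasure Ω | ∀ X ∈ D, signedIntegral μ X ≤ φ X} s →
        ∃ a : ℝ, s = a • P.toSignedMeasure) ∧
    (∀ s : SignedMeasure Ω,
      IsGLB {μ : SignedMeasure Ω | ∀ X ∈ D, φ X ≤ signedIntegral μ X} s →
        ∃ b : ℝ, s = b • P.toSignedMeasure) := by
  have h : Atomless P := hatomless
  refine ⟨fun s hs => h.exists_eq_smul_of_isLUB_lowerSupport hne hDmeas hDbdd hDinv hφinv hs,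
    fun s hs => ?_⟩
  have hneg : ∀ μ : SignedMeasure Ω, (∀ X ∈ D, φ X ≤ signedIntegral μ X) ↔
      -μ ∈ lowerSupport D fun X => -φ X := by
    intro μ
    simp [lowerSupport, signedIntegral_neg]
  have hlub : IsLUB (lowerSupport D fun X => -φ X) (-s) := by
    constructor
    · intro μ hμ A hA
      have := hs.1 ((hneg (-μ)).2 (by rwa [neg_neg])) A hA
      simp only [_root_.neg_apply] at this ⊢
      linarith
    · intro ν hν A hA
      have hlower : -ν ≤ s := hs.2 fun μ hμ B hB => by
        have := hν ((hneg μ).1 hμ) B hB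
        simp only [_root_.neg_apply] at this ⊢
        linarith
      have := hlower A hA
      simp only [_root_.neg_apply] at this ⊢
      linarith
  obtain ⟨a, ha⟩ := h.exists_eq_smul_of_isLUB_lowerSupport hne hDmeas hDbdd hDinv
    (fun X hX Y hY hXY => congrArg Neg.neg (hφinv X hX Y hY hXY)) hlub
  refine ⟨-a, ?_⟩
  ext A hA
  have := congrArg (fun m : SignedMeasure Ω => m A) ha
  simp only [_root_.neg_apply, _root_.smul_apply, smul_eq_mul] at this ⊢
  linarith
end

section
/- Let ℙ be an atomless probability measure on a σ-algebra Σ and let Z be a nonempty set of (ℙ-equivalence classes of) real-valued random variables such that: (a) Z is upper bounded, i.e., there exists a random variable Y with Z ≤ Y ℙ-a.s. for all Z ∈ Z; and (b) Z is ℙ-invariant, i.e., Z ∈ Z and Z′ ∼_ℙ Z imply Z′ ∈ Z. Then the supremum of Z in the ℙ-a.s. order exists and is ℙ-a.s. equal to a real constant. In particular, if every Z ∈ Z satisfies Z ≥ 0 ℙ-a.s., then every Z ∈ Z is ℙ-a.s. bounded. -/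
open MeasureTheory

namespace MeasureTheory

variable {Ω : Type*} [MeasurableSpace Ω]

/-- Every measurable set of positive measure has a measurable subset of strictly smaller
positive measure. -/
def Measure.Atomless (μ : Measure Ω) : Prop :=
  ∀ A : Set Ω, MeasurableSet A → 0 < μ A →
    ∃ B : Set Ω, MeasurableSet B ∧ B ⊆ A ∧ 0 < μ B ∧ μ B < μ A

lemma Measure.Atomless.restrict {μ : Measure Ω} (h : μ.Atomless) {S : Set Ω}
    (hS : MeasurableSet S) : (μ.restrict S).Atomless := by
  intro A hA hpos
  rw [Measure.restrict_apply hA] at hpos ⊢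
  obtain ⟨B, hB, hBA, hB0, hB1⟩ := h _ (hA.inter hS) hpos
  refine ⟨B, hB, hBA.trans Set.inter_subset_left, ?_⟩
  rw [Measure.restrict_apply hB, Set.inter_eq_left.2 (hBA.trans Set.inter_subset_right)]
  exact ⟨hB0, hB1⟩

/-- Strict inclusion of measurable sets with strict increase of the measure. -/
def Measure.StrictSubset (μ : Measure Ω) (A B : {A : Set Ω // MeasurableSet A}) : Prop :=
  A.1 ⊆ B.1 ∧ μ A.1 < μ B.1

lemma subset_of_isChain_of_measure_le {μ : Measure Ω} {C : Set {A : Set Ω // MeasurableSet A}}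
    (hC : IsChain μ.StrictSubset C) {A B : {A : Set Ω // MeasurableSet A}}
    (hA : A ∈ C) (hB : B ∈ C) (h : μ A.1 ≤ μ B.1) : A.1 ⊆ B.1 := by
  by_cases hAB : A = B
  · rw [hAB]
  · rcases hC hA hB hAB with h1 | h1
    · exact h1.1
    · exact absurd h1.2 (not_lt.2 h)

/-- A maximal chain attains the measure of every measurable set comparable to all its members. -/
lemma exists_measure_eq_of_isMaxChain {μ : Measure Ω} {C : Set {A : Set Ω // MeasurableSet A}}
    (hC : IsMaxChain μ.StrictSubset C) {X : Set Ω} (hX : MeasurableSet X)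
    (hcomp : ∀ D ∈ C, D.1 ⊆ X ∨ X ⊆ D.1) : ∃ D ∈ C, μ D.1 = μ X := by
  by_contra! hne
  refine hne ⟨X, hX⟩ ?_ rfl
  have hins : IsChain μ.StrictSubset (insert ⟨X, hX⟩ C) := by
    refine hC.1.insert fun D hD _ => ?_
    rcases hcomp D hD with h | h
    · exact Or.inr ⟨h, lt_of_le_of_ne (measure_mono h) (hne D hD)⟩
    · exact Or.inl ⟨h, lt_of_le_of_ne (measure_mono h) (hne D hD).symm⟩
  rw [hC.2 hins (Set.subset_insert _ _)]
  exact Set.mem_insert _ _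

lemma exists_greatest_measure_le_of_isMaxChain {μ : Measure Ω}
    {C : Set {A : Set Ω // MeasurableSet A}} (hC : IsMaxChain μ.StrictSubset C) (t : ENNReal) :
    ∃ S ∈ C, μ S.1 ≤ t ∧ ∀ D ∈ C, μ D.1 ≤ t → μ D.1 ≤ μ S.1 := by
  let V : Set ENNReal := (fun D => μ D.1) '' {D | D ∈ C ∧ μ D.1 ≤ t}
  have hV : V.Nonempty := by
    obtain ⟨D, hD, h0⟩ := exists_measure_eq_of_isMaxChain hC MeasurableSet.empty
      fun D _ => Or.inr (Set.empty_subset _)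
    exact ⟨_, D, ⟨hD, by simp [h0]⟩, rfl⟩
  obtain ⟨u, hu, hlim, huV⟩ := exists_seq_tendsto_sSup hV (OrderTop.bddAbove V)
  choose D hD hDu using huV
  have hmono : Monotone fun n => (D n).1 := fun m n hmn =>
    subset_of_isChain_of_measure_le hC.1 (hD m).1 (hD n).1 (by simpa [hDu] using hu hmn)
  have hmeas : μ (⋃ n, (D n).1) = sSup V :=
    tendsto_nhds_unique (tendsto_measure_iUnion_atTop hmono)
      (by simpa [Function.comp_def, hDu] using hlim)
  obtain ⟨S, hS, hSm⟩ := exists_measure_eq_of_isMaxChain hC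
    (MeasurableSet.iUnion fun n => (D n).2) (X := ⋃ n, (D n).1) (by
      intro E hE
      by_cases h : ∃ n, μ E.1 ≤ μ (D n).1
      · obtain ⟨n, hn⟩ := h
        exact Or.inl ((subset_of_isChain_of_measure_le hC.1 hE (hD n).1 hn).trans
          (Set.subset_iUnion (fun n => (D n).1) n))
      · push Not at h
        exact Or.inr (Set.iUnion_subset fun n =>
          subset_of_isChain_of_measure_le hC.1 (hD n).1 hE (h n).le))
  refine ⟨S, hS, ?_, fun E hE hEt => ?_⟩
  · rw [hSm, hmeas]
    exact sSup_le (by rintro _ ⟨E, hE, rfl⟩; exact hE.2)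
  · rw [hSm, hmeas]
    exact le_sSup ⟨E, ⟨hE, hEt⟩, rfl⟩

lemma exists_least_le_measure_of_isMaxChain {μ : Measure Ω} [IsFiniteMeasure μ]
    {C : Set {A : Set Ω // MeasurableSet A}} (hC : IsMaxChain μ.StrictSubset C) {t : ENNReal}
    (ht : t ≤ μ Set.univ) :
    ∃ T ∈ C, t ≤ μ T.1 ∧ ∀ D ∈ C, t ≤ μ D.1 → μ T.1 ≤ μ D.1 := by
  let V : Set ENNReal := (fun D => μ D.1) '' {D | D ∈ C ∧ t ≤ μ D.1}
  have hV : V.Nonempty := by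
    obtain ⟨D, hD, h0⟩ := exists_measure_eq_of_isMaxChain hC MeasurableSet.univ
      fun D _ => Or.inl (Set.subset_univ _)
    exact ⟨_, D, ⟨hD, by rwa [h0]⟩, rfl⟩
  obtain ⟨u, hu, hlim, huV⟩ := exists_seq_tendsto_sInf hV (OrderBot.bddBelow V)
  choose D hD hDu using huV
  have hanti : Antitone fun n => (D n).1 := fun m n hmn =>
    subset_of_isChain_of_measure_le hC.1 (hD n).1 (hD m).1 (by simpa [hDu] using hu hmn)
  have hmeas : μ (⋂ n, (D n).1) = sInf V :=
    tendsto_nhds_unique (tendsto_measure_iInter_atTop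
      (fun n => (D n).2.nullMeasurableSet) hanti ⟨0, measure_ne_top _ _⟩)
      (by simpa [Function.comp_def, hDu] using hlim)
  obtain ⟨T, hT, hTm⟩ := exists_measure_eq_of_isMaxChain hC
    (MeasurableSet.iInter fun n => (D n).2) (X := ⋂ n, (D n).1) (by
      intro E hE
      by_cases h : ∃ n, μ (D n).1 ≤ μ E.1
      · obtain ⟨n, hn⟩ := h
        exact Or.inr ((Set.iInter_subset (fun n => (D n).1) n).trans
          (subset_of_isChain_of_measure_le hC.1 (hD n).1 hE hn))
      · push Not at h
        exact Or.inl (Set.subset_iInter fun n =>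
          subset_of_isChain_of_measure_le hC.1 hE (hD n).1 (h n).le))
  refine ⟨T, hT, ?_, fun E hE hEt => ?_⟩
  · rw [hTm, hmeas]
    exact le_sInf (by rintro _ ⟨E, hE, rfl⟩; exact hE.2)
  · rw [hTm, hmeas]
    exact sInf_le ⟨E, ⟨hE, hEt⟩, rfl⟩

lemma Measure.Atomless.exists_mem_isMaxChain {μ : Measure Ω} [IsFiniteMeasure μ]
    (hμ : μ.Atomless) {C : Set {A : Set Ω // MeasurableSet A}}
    (hC : IsMaxChain μ.StrictSubset C) {t : ENNReal} (ht : t ≤ μ Set.univ) :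
    ∃ D ∈ C, μ D.1 = t := by
  obtain ⟨S, hS, hSt, hSmax⟩ := exists_greatest_measure_le_of_isMaxChain hC t
  obtain ⟨T, hT, hTt, hTmin⟩ := exists_least_le_measure_of_isMaxChain hC ht
  by_contra! hne
  have hlt : μ S.1 < μ T.1 := (lt_of_le_of_ne hSt (hne S hS)).trans_le hTt
  have hST := subset_of_isChain_of_measure_le hC.1 hS hT hlt.le
  obtain ⟨B, hB, hBsub, hB0, hB1⟩ := hμ (T.1 \ S.1) (T.2.diff S.2)
    ((tsub_pos_of_lt hlt).trans_le le_measure_sdiff)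
  have hdisj : Disjoint S.1 B := Set.disjoint_left.2 fun x hx hxB => (hBsub hxB).2 hx
  obtain ⟨D, hD, hDm⟩ := exists_measure_eq_of_isMaxChain hC (S.2.union hB) (by
    intro E hE
    rcases le_total (μ E.1) t with h | h
    · exact Or.inl ((subset_of_isChain_of_measure_le hC.1 hE hS (hSmax E hE h)).trans
        Set.subset_union_left)
    · exact Or.inr ((Set.union_subset hST (hBsub.trans Set.sdiff_subset)).trans
        (subset_of_isChain_of_measure_le hC.1 hT hE (hTmin E hE h))))
  have hgt : μ S.1 < μ D.1 := by
    rw [hDm, measure_union hdisj hB]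
    exact ENNReal.lt_add_right (measure_ne_top _ _) hB0.ne'
  have hlt' : μ D.1 < μ T.1 := by
    rw [hDm, measure_union hdisj hB, ← Set.union_sdiff_cancel hST,
      measure_union Set.disjoint_sdiff_right (T.2.diff S.2)]
    exact ENNReal.add_lt_add_left (measure_ne_top _ _) hB1
  rcases le_total (μ D.1) t with h | h
  · exact (hSmax D hD h).not_gt hgt
  · exact (hTmin D hD h).not_gt hlt'

/-- An atomless finite measure admits a nested family of measurable sets of every
possible measure. -/
lemma Measure.Atomless.exists_nested {μ : Measure Ω} [IsFiniteMeasure μ] (hμ : μ.Atomless) :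
    ∃ E : ENNReal → Set Ω, (∀ t, MeasurableSet (E t)) ∧
      (∀ s t, s ≤ t → t ≤ μ Set.univ → E s ⊆ E t) ∧ ∀ t ≤ μ Set.univ, μ (E t) = t := by
  classical
  have hC : IsMaxChain μ.StrictSubset (maxChain μ.StrictSubset) := maxChain_spec
  choose D hDC hD using fun (t : ENNReal) (ht : t ≤ μ Set.univ) =>
    hμ.exists_mem_isMaxChain hC ht
  refine ⟨fun t => if h : t ≤ μ Set.univ then (D t h).1 else ∅, fun t => ?_,
    fun s t hst ht => ?_, fun t ht => ?_⟩
  · dsimp only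
    split_ifs with h
    exacts [(D t h).2, MeasurableSet.empty]
  · simp only [hst.trans ht, ht, dite_true]
    exact subset_of_isChain_of_measure_le hC.1 (hDC _ _) (hDC _ _) (by rwa [hD, hD])
  · simp only [ht, dite_true, hD]

/-- An atomless finite measure can be mapped to any measure on `ℝ` with the same mass. -/
lemma Measure.Atomless.exists_map_eq {μ : Measure Ω} [IsFiniteMeasure μ] (hμ : μ.Atomless)
    (ν : Measure ℝ) (hν : ν Set.univ = μ Set.univ) :
    ∃ g : Ω → ℝ, Measurable g ∧ μ.map g = ν := by
  classical
  have : IsFiniteMeasure ν := ⟨by rw [hν]; exact measure_lt_top _ _⟩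
  obtain ⟨E, hEm, hEmono, hE⟩ := hμ.exists_nested
  have hle : ∀ q : ℚ, ν (Set.Iic (q : ℝ)) ≤ μ Set.univ := fun q =>
    hν ▸ measure_mono (Set.subset_univ _)
  let F : ℚ → Set Ω := fun q => E (ν (Set.Iic (q : ℝ)))
  have hF : Monotone F := fun p q hpq =>
    hEmono _ _ (measure_mono (Set.Iic_subset_Iic.2 (by exact_mod_cast hpq))) (hle q)
  let G : Ω → EReal := fun ω => ⨅ q : ℚ, if ω ∈ F q then ((q : ℝ) : EReal) else ⊤
  have hG : Measurable G := Measurable.iInf fun q =>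
    Measurable.ite (hEm _) measurable_const measurable_const
  have hmap : μ.map G = ν.map ((↑) : ℝ → EReal) := by
    have hIio : ∀ x : EReal, μ.map G (Set.Iio x) = ν.map ((↑) : ℝ → EReal) (Set.Iio x) := by
      intro x
      rw [Measure.map_apply hG measurableSet_Iio,
        Measure.map_apply measurable_coe_real_ereal measurableSet_Iio]
      have h1 : G ⁻¹' Set.Iio x = ⋃ q : {q : ℚ // ((q : ℝ) : EReal) < x}, F q := by
        ext ω
        simp only [Set.mem_preimage, Set.mem_Iio, G, iInf_lt_iff, Set.mem_iUnion, Subtype.exists,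
          exists_prop]
        refine exists_congr fun q => ?_
        split_ifs with h <;> simp [h]
      have h2 : ((↑) : ℝ → EReal) ⁻¹' Set.Iio x =
          ⋃ q : {q : ℚ // ((q : ℝ) : EReal) < x}, Set.Iic ((q : ℚ) : ℝ) := by
        ext y
        simp only [Set.mem_preimage, Set.mem_Iio, Set.mem_iUnion, Subtype.exists, Set.mem_Iic,
          exists_prop]
        constructor
        · intro h
          obtain ⟨q, hq1, hq2⟩ := EReal.lt_iff_exists_rat_btwn.1 h
          exact ⟨q, hq2, (EReal.coe_lt_coe_iff.1 hq1).le⟩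
        · rintro ⟨q, hq, hyq⟩
          exact (EReal.coe_le_coe_iff.2 hyq).trans_lt hq
      have hd1 : Monotone fun q : {q : ℚ // ((q : ℝ) : EReal) < x} => F q := fun p q hpq => hF hpq
      have hd2 : Monotone fun q : {q : ℚ // ((q : ℝ) : EReal) < x} => Set.Iic ((q : ℚ) : ℝ) :=
        fun p q hpq => Set.Iic_subset_Iic.2 (Rat.cast_le.2 hpq)
      rw [h1, h2, hd1.directed_le.measure_iUnion, hd2.directed_le.measure_iUnion]
      exact iSup_congr fun q => hE _ (hle q)
    refine Measure.ext_of_Ici _ _ fun x => ?_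
    rw [← Set.compl_Iio, measure_compl measurableSet_Iio (measure_ne_top _ _),
      measure_compl measurableSet_Iio (measure_ne_top _ _), hIio,
      Measure.map_apply hG MeasurableSet.univ,
      Measure.map_apply measurable_coe_real_ereal MeasurableSet.univ, Set.preimage_univ,
      Set.preimage_univ, hν]
  refine ⟨fun ω => (G ω).toReal, hG.ereal_toReal, ?_⟩
  have h := congrArg (Measure.map EReal.toReal) hmap
  rw [Measure.map_map measurable_ereal_toReal hG,
    Measure.map_map measurable_ereal_toReal measurable_coe_real_ereal] at h
  simpa [Function.comp_def] using h

lemma Measure.Atomless.exists_subset_measure_eq {μ : Measure Ω} [IsFiniteMeasure μ]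
    (hμ : μ.Atomless) {A : Set Ω} (hA : MeasurableSet A) {t : ENNReal} (ht : t ≤ μ A) :
    ∃ B ⊆ A, MeasurableSet B ∧ μ B = t := by
  obtain ⟨E, hEm, -, hE⟩ := (hμ.restrict hA).exists_nested
  refine ⟨E t ∩ A, Set.inter_subset_right, (hEm t).inter hA, ?_⟩
  rw [← Measure.restrict_apply (hEm t)]
  exact hE t (by simpa using ht)

/-- If `f` exceeds `q` with positive probability and `B` is non-null, some equidistributed
copy of `f` exceeds `q` on a non-null part of `B`. -/
lemma Measure.Atomless.exists_equidistributed {μ : Measure Ω} [IsFiniteMeasure μ]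
    (hμ : μ.Atomless) {f : Ω → ℝ} (hf : Measurable f) {q : ℝ} (hq : μ {ω | q < f ω} ≠ 0)
    {B : Set Ω} (hB : MeasurableSet B) (hB0 : μ B ≠ 0) :
    ∃ g : Ω → ℝ, Measurable g ∧ μ.map g = μ.map f ∧ μ ({ω | q < g ω} ∩ B) ≠ 0 := by
  classical
  have hA : MeasurableSet {ω | q < f ω} := measurableSet_lt measurable_const hf
  obtain ⟨A', hA'sub, hA', hA't⟩ :=
    hμ.exists_subset_measure_eq hA (min_le_left (μ {ω | q < f ω}) (μ B))
  obtain ⟨B', hB'sub, hB', hB't⟩ :=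
    hμ.exists_subset_measure_eq hB (min_le_right (μ {ω | q < f ω}) (μ B))
  have hAB : μ A' = μ B' := hA't.trans hB't.symm
  have hpos : μ B' ≠ 0 := by
    rw [hB't]
    rcases min_choice (μ {ω | q < f ω}) (μ B) with h | h <;> rwa [h]
  obtain ⟨g₁, hg₁, hmap₁⟩ := (hμ.restrict hB').exists_map_eq ((μ.restrict A').map f)
    (by simp [Measure.map_apply hf MeasurableSet.univ, hAB])
  obtain ⟨g₂, hg₂, hmap₂⟩ := (hμ.restrict hB'.compl).exists_map_eq ((μ.restrict A'ᶜ).map f)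
    (by simp [Measure.map_apply hf MeasurableSet.univ, measure_compl hA' (measure_ne_top _ _),
      measure_compl hB' (measure_ne_top _ _), hAB])
  have hg : Measurable (B'.piecewise g₁ g₂) := hg₁.piecewise hB' hg₂
  refine ⟨B'.piecewise g₁ g₂, hg, ?_, ?_⟩
  · rw [← Measure.restrict_add_restrict_compl (μ := μ) hB', Measure.map_add _ _ hg,
      Measure.map_congr (piecewise_ae_eq_restrict hB'),
      Measure.map_congr (piecewise_ae_eq_restrict_compl hB'), hmap₁, hmap₂,
      ← Measure.map_add _ _ hf, Measure.restrict_add_restrict_compl hA',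
      Measure.restrict_add_restrict_compl hB']
  · have h1 : μ ({ω | q < g₁ ω} ∩ B') = μ B' := by
      have h := congrArg (fun ν : Measure ℝ => ν (Set.Ioi q)) hmap₁
      simp only [Measure.map_apply hg₁ measurableSet_Ioi, Measure.map_apply hf measurableSet_Ioi,
        Measure.restrict_apply (hg₁ measurableSet_Ioi),
        Measure.restrict_apply (hf measurableSet_Ioi)] at h
      rw [← hAB, ← Set.inter_eq_right.2 hA'sub]
      exact h
    refine fun h0 => hpos (h1 ▸ measure_mono_null ?_ h0)
    rintro ω ⟨hω, hωB⟩
    exact ⟨by simpa [Set.piecewise_eq_of_mem _ _ _ hωB] using hω, hB'sub hωB⟩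

end MeasureTheory

/-- Let `P` be an atomless probability measure and `Z` a nonempty,
upper-bounded, `P`-invariant set of (equivalence classes of) random variables. Then the
supremum of `Z` in the `P`-a.s. order exists and is `P`-a.s. equal to a real constant:
there is a constant `c` which is an a.s. upper bound of `Z` and is a.s. below every
(measurable) a.s. upper bound of `Z`. In particular, if every member of `Z` is a.s.
nonnegative, then every member of `Z` is a.s. bounded. -/
theorem stmt2 {Ω : Type*} [MeasurableSpace Ω] (P : Measure Ω) [IsProbabilityMeasure P]
    (hatomless : ∀ A : Set Ω, MeasurableSet A → 0 < P A →
      ∃ B : Set Ω, MeasurableSet B ∧ B ⊆ A ∧ 0 < P B ∧ P B < P A)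
    (Z : Set (Ω → ℝ)) (hne : Z.Nonempty) (hmeas : ∀ f ∈ Z, Measurable f)
    (hbdd : ∃ Y : Ω → ℝ, Measurable Y ∧ ∀ f ∈ Z, f ≤ᵐ[P] Y)
    (hinv : ∀ f ∈ Z, ∀ g : Ω → ℝ, Measurable g → P.map g = P.map f → g ∈ Z) :
    (∃ c : ℝ, (∀ f ∈ Z, f ≤ᵐ[P] fun _ => c) ∧
      ∀ Y : Ω → ℝ, Measurable Y → (∀ f ∈ Z, f ≤ᵐ[P] Y) → (fun _ => c) ≤ᵐ[P] Y) ∧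
    ((∀ f ∈ Z, (fun _ => (0 : ℝ)) ≤ᵐ[P] f) →
      ∀ f ∈ Z, ∃ C : ℝ, ∀ᵐ ω ∂P, |f ω| ≤ C) := by
  have hP : P.Atomless := hatomless
  let Q : Set ℝ := {q | ∃ f ∈ Z, P {ω | q < f ω} ≠ 0}
  have key : ∀ q ∈ Q, ∀ Y : Ω → ℝ, Measurable Y → (∀ f ∈ Z, f ≤ᵐ[P] Y) →
      ∀ᵐ ω ∂P, q ≤ Y ω := by
    rintro q ⟨f, hf, hq⟩ Y hY hYub
    by_contra hcon
    have hB0 : P {ω | Y ω < q} ≠ 0 := by simpa [ae_iff] using hcon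
    obtain ⟨g, hg, hmap, hpos⟩ := hP.exists_equidistributed (hmeas f hf) hq
      (measurableSet_lt hY measurable_const) hB0
    refine hpos (measure_mono_null ?_ (ae_iff.1 (hYub g (hinv f hf g hg hmap))))
    rintro ω ⟨h1, h2⟩
    exact not_le.2 (lt_trans h2 h1)
  have hnotMem : ∀ f ∈ Z, ∀ q ∉ Q, ∀ᵐ ω ∂P, f ω ≤ q := by
    intro f hf q hq
    by_contra hcon
    exact hq ⟨f, hf, by simpa [ae_iff] using hcon⟩
  have hQne : Q.Nonempty := by
    by_contra hQ
    rw [Set.not_nonempty_iff_eq_empty] at hQ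
    obtain ⟨f, hf⟩ := hne
    have hall : ∀ᵐ ω ∂P, ∀ n : ℤ, f ω ≤ n :=
      ae_all_iff.2 fun n => hnotMem f hf n (by simp [hQ])
    obtain ⟨ω, hω⟩ := hall.exists
    obtain ⟨n, hn⟩ := exists_int_lt (f ω)
    exact (hω n).not_gt hn
  have hQbdd : BddAbove Q := by
    obtain ⟨Y, hY, hYub⟩ := hbdd
    by_contra hQ
    rw [not_bddAbove_iff] at hQ
    have hall : ∀ᵐ ω ∂P, ∀ n : ℕ, (n : ℝ) ≤ Y ω := by
      refine ae_all_iff.2 fun n => ?_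
      obtain ⟨q, hq, hnq⟩ := hQ n
      filter_upwards [key q hq Y hY hYub] with ω hω using hnq.le.trans hω
    obtain ⟨ω, hω⟩ := hall.exists
    obtain ⟨n, hn⟩ := exists_nat_gt (Y ω)
    exact (hω n).not_gt hn
  have hub : ∀ f ∈ Z, f ≤ᵐ[P] fun _ => sSup Q := by
    intro f hf
    have hall : ∀ᵐ ω ∂P, ∀ q : ℚ, sSup Q < q → f ω ≤ q :=
      ae_all_iff.2 fun q => Filter.eventually_imp_distrib_left.2 fun hq =>
        hnotMem f hf q fun hmem => (le_csSup hQbdd hmem).not_gt hq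
    filter_upwards [hall] with ω hω
    by_contra! hlt
    obtain ⟨q, hq1, hq2⟩ := exists_rat_btwn hlt
    exact (hω q hq1).not_gt hq2
  refine ⟨⟨sSup Q, hub, fun Y hY hYub => ?_⟩, fun hnn f hf => ⟨sSup Q, ?_⟩⟩
  · have hall : ∀ᵐ ω ∂P, ∀ q : ℚ, (q : ℝ) < sSup Q → q ≤ Y ω := by
      refine ae_all_iff.2 fun q => Filter.eventually_imp_distrib_left.2 fun hq => ?_
      obtain ⟨r, hr, hqr⟩ := exists_lt_of_lt_csSup hQne hq
      filter_upwards [key r hr Y hY hYub] with ω hω using hqr.le.trans hω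
    filter_upwards [hall] with ω hω
    by_contra! hlt
    obtain ⟨q, hq1, hq2⟩ := exists_rat_btwn hlt
    exact (hω q hq2).not_gt hq1
  · filter_upwards [hub f hf, hnn f hf] with ω h1 h2
    rwa [abs_of_nonneg h2]
end

section
/- Let P be a convex-ranged probability charge on an algebra Σ, let D be a nonempty P-invariant subset of the space B_s(Σ) of simple Σ-measurable random variables, and let φ : D → ℝ be P-invariant. Define L^f = {μ ∈ ba : ∀ X ∈ D, ∫ X dμ ≤ φ(X)} and U^f = {μ ∈ ba : ∀ X ∈ D, ∫ X dμ ≥ φ(X)}. (i) If sup L^f exists in ba (setwise order), then there is a constant a ∈ ℝ with sup L^f = a·P. (ii) If inf U^f exists in ba, then there is a constant b ∈ ℝ with inf U^f = b·P. -/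
/-- A bounded signed charge on the algebra `S` of subsets of `Ω`: a finitely additive,
bounded real-valued set function, normalised to vanish outside `S`. -/
structure Charge {Ω : Type*} (S : Set (Set Ω)) where
  toFun : Set Ω → ℝ
  zero_of_not_mem : ∀ A : Set Ω, A ∉ S → toFun A = 0
  additive : ∀ A B : Set Ω, A ∈ S → B ∈ S → Disjoint A B → toFun (A ∪ B) = toFun A + toFun B
  bounded : ∃ C : ℝ, ∀ A : Set Ω, |toFun A| ≤ C

namespace Charge

variable {Ω : Type*} {S : Set (Set Ω)}

theorem ext' {μ ν : Charge S} (h : μ.toFun = ν.toFun) : μ = ν := by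
  cases μ; cases ν; simpa using h

noncomputable instance : SMul ℝ (Charge S) :=
  ⟨fun a μ =>
    { toFun := fun A => a * μ.toFun A
      zero_of_not_mem := fun A hA => by
        show a * μ.toFun A = 0
        rw [μ.zero_of_not_mem A hA, mul_zero]
      additive := fun A B hA hB hAB => by
        show a * μ.toFun (A ∪ B) = a * μ.toFun A + a * μ.toFun B
        rw [μ.additive A B hA hB hAB]; ring
      bounded := by
        obtain ⟨C, hC⟩ := μ.bounded
        refine ⟨|a| * C, fun A => ?_⟩
        show |a * μ.toFun A| ≤ |a| * C
        rw [abs_mul]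
        exact mul_le_mul_of_nonneg_left (hC A) (abs_nonneg a) }⟩

@[simp] theorem smul_toFun (a : ℝ) (μ : Charge S) (A : Set Ω) :
    (a • μ).toFun A = a * μ.toFun A := rfl

/-- The setwise (partial) order on bounded charges. -/
instance : PartialOrder (Charge S) where
  le μ ν := ∀ A ∈ S, μ.toFun A ≤ ν.toFun A
  le_refl μ A _ := le_refl _
  le_trans μ ν ξ h1 h2 A hA := le_trans (h1 A hA) (h2 A hA)
  le_antisymm μ ν h1 h2 := ext' (funext fun A => by
    by_cases hA : A ∈ S
    · exact le_antisymm (h1 A hA) (h2 A hA)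
    · rw [μ.zero_of_not_mem A hA, ν.zero_of_not_mem A hA])

theorem le_def {μ ν : Charge S} : μ ≤ ν ↔ ∀ A ∈ S, μ.toFun A ≤ ν.toFun A := Iff.rfl

end Charge

/-- A probability charge: nonnegative, with total mass one. -/
def IsProbCharge {Ω : Type*} {S : Set (Set Ω)} (P : Charge S) : Prop :=
  P.toFun Set.univ = 1 ∧ ∀ A : Set Ω, 0 ≤ P.toFun A

/-- A charge `P` has convex range if for every `A ∈ S` the set of values `P(B)`,
`B ∈ S`, `B ⊆ A`, is the full interval `[0, P(A)]`. -/
def HasConvexRange {Ω : Type*} {S : Set (Set Ω)} (P : Charge S) : Prop :=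
  ∀ A ∈ S, {x : ℝ | ∃ B ∈ S, B ⊆ A ∧ P.toFun B = x} = Set.Icc 0 (P.toFun A)

/-- The loose anticore of a set function `v`. -/
def LooseAnticore {Ω : Type*} {S : Set (Set Ω)} (v : Set Ω → ℝ) : Set (Charge S) :=
  {μ | ∀ A ∈ S, μ.toFun A ≤ v A}

/-- The anticore of a set function `v`. -/
def Anticore {Ω : Type*} {S : Set (Set Ω)} (v : Set Ω → ℝ) : Set (Charge S) :=
  {μ | μ ∈ LooseAnticore v ∧ μ.toFun Set.univ = v Set.univ}

/-- The loose core of a set function `v`. -/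
def LooseCore {Ω : Type*} {S : Set (Set Ω)} (v : Set Ω → ℝ) : Set (Charge S) :=
  {μ | ∀ A ∈ S, v A ≤ μ.toFun A}

/-- The core of a set function `v`. -/
def Core {Ω : Type*} {S : Set (Set Ω)} (v : Set Ω → ℝ) : Set (Charge S) :=
  {μ | μ ∈ LooseCore v ∧ μ.toFun Set.univ = v Set.univ}

/-- `X` is a simple random variable over the algebra `S`. -/
def IsSimpleRV {Ω : Type*} (S : Set (Set Ω)) (X : Ω → ℝ) : Prop :=
  (Set.range X).Finite ∧ ∀ x : ℝ, X ⁻¹' {x} ∈ S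

/-- The integral of a simple random variable `X` with respect to the charge `μ`. -/
noncomputable def simpleInt {Ω : Type*} {S : Set (Set Ω)} (μ : Charge S) (X : Ω → ℝ) : ℝ :=
  ∑ᶠ x : ℝ, x * μ.toFun (X ⁻¹' {x})

namespace Charge

open MeasureTheory

variable {Ω : Type*} {S : Set (Set Ω)}

theorem apply_empty (hS : IsSetAlgebra S) (μ : Charge S) : μ.toFun ∅ = 0 := by
  have h := μ.additive ∅ ∅ hS.empty_mem hS.empty_mem (by simp)
  simp at h
  exact h

theorem apply_inter_add_diff (hS : IsSetAlgebra S) (μ : Charge S) {A B : Set Ω}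
    (hA : A ∈ S) (hB : B ∈ S) : μ.toFun (A ∩ B) + μ.toFun (A \ B) = μ.toFun A := by
  rw [← μ.additive _ _ (hS.inter_mem hA hB) (hS.sdiff_mem hA hB)
    (Set.disjoint_sdiff_inter.symm), Set.inter_union_sdiff]

theorem apply_diff (hS : IsSetAlgebra S) (μ : Charge S) {A B : Set Ω}
    (hA : A ∈ S) (hB : B ∈ S) (h : B ⊆ A) : μ.toFun (A \ B) = μ.toFun A - μ.toFun B := by
  have := μ.apply_inter_add_diff hS hA hB
  rw [Set.inter_eq_self_of_subset_right h] at this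
  linarith

theorem apply_add_compl (hS : IsSetAlgebra S) (μ : Charge S) {A : Set Ω} (hA : A ∈ S) :
    μ.toFun A + μ.toFun Aᶜ = μ.toFun Set.univ := by
  simpa [Set.compl_eq_univ_sdiff] using μ.apply_inter_add_diff hS hS.univ_mem hA

instance : Add (Charge S) where
  add μ ν :=
    { toFun := fun A => μ.toFun A + ν.toFun A
      zero_of_not_mem := fun A hA => by
        simp [μ.zero_of_not_mem A hA, ν.zero_of_not_mem A hA]
      additive := fun A B hA hB hAB => by
        rw [μ.additive A B hA hB hAB, ν.additive A B hA hB hAB]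
        ring
      bounded := by
        obtain ⟨C, hC⟩ := μ.bounded
        obtain ⟨C', hC'⟩ := ν.bounded
        exact ⟨C + C', fun A => (abs_add_le _ _).trans (add_le_add (hC A) (hC' A))⟩ }

@[simp] theorem add_toFun (μ ν : Charge S) (A : Set Ω) :
    (μ + ν).toFun A = μ.toFun A + ν.toFun A := rfl

open Classical in
/-- The restriction `E ↦ μ (E ∩ A)` of a charge to a member `A` of the algebra. -/
noncomputable def restrict (hS : IsSetAlgebra S) (μ : Charge S) (A : Set Ω) (hA : A ∈ S) :
    Charge S where
  toFun E := if E ∈ S then μ.toFun (E ∩ A) else 0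
  zero_of_not_mem E hE := if_neg hE
  additive E F hE hF hEF := by
    rw [if_pos hE, if_pos hF, if_pos (hS.union_mem hE hF), Set.union_inter_distrib_right]
    exact μ.additive _ _ (hS.inter_mem hE hA) (hS.inter_mem hF hA)
      (hEF.mono Set.inter_subset_left Set.inter_subset_left)
  bounded := by
    obtain ⟨C, hC⟩ := μ.bounded
    refine ⟨C, fun E => ?_⟩
    split_ifs
    · exact hC _
    · simpa using (abs_nonneg _).trans (hC ∅)

theorem restrict_apply (hS : IsSetAlgebra S) (μ : Charge S) {A E : Set Ω} (hA : A ∈ S)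
    (hE : E ∈ S) : (μ.restrict hS A hA).toFun E = μ.toFun (E ∩ A) := if_pos hE

theorem sum_apply_inter_fiber (hS : IsSetAlgebra S) (μ : Charge S) {A : Set Ω} (X : Ω → ℝ)
    (hX : ∀ x, A ∩ X ⁻¹' {x} ∈ S) (J : Finset ℝ) (hJ : ∀ ω ∈ A, X ω ∈ J) :
    ∑ x ∈ J, μ.toFun (A ∩ X ⁻¹' {x}) = μ.toFun A := by
  have key : ∀ K : Finset ℝ, A ∩ X ⁻¹' (K : Set ℝ) ∈ S ∧
      ∑ x ∈ K, μ.toFun (A ∩ X ⁻¹' {x}) = μ.toFun (A ∩ X ⁻¹' (K : Set ℝ)) := by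
    intro K
    induction K using Finset.induction_on with
    | empty => simp [hS.empty_mem, apply_empty hS]
    | insert a K ha ih =>
      have hU : A ∩ X ⁻¹' ((insert a K : Finset ℝ) : Set ℝ)
          = (A ∩ X ⁻¹' {a}) ∪ (A ∩ X ⁻¹' (K : Set ℝ)) := by
        ext ω
        simp
        tauto
      rw [hU, Finset.sum_insert ha, ih.2, μ.additive _ _ (hX a) ih.1]
      · exact ⟨hS.union_mem (hX a) ih.1, rfl⟩
      · rw [Set.disjoint_left]
        rintro ω ⟨-, h1⟩ ⟨-, h2⟩
        simp only [Set.mem_preimage, Set.mem_singleton_iff] at h1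
        rw [Set.mem_preimage, h1] at h2
        exact ha h2
  rw [(key J).2]
  congr 1
  ext ω
  simpa using hJ ω

theorem simpleInt_eq_sum (hS : IsSetAlgebra S) (μ : Charge S) {X : Ω → ℝ} (J : Finset ℝ)
    (hJ : ∀ ω, X ω ∈ J) : simpleInt μ X = ∑ x ∈ J, x * μ.toFun (X ⁻¹' {x}) := by
  refine finsum_eq_sum_of_support_subset _ fun x hx => ?_
  by_contra hxJ
  refine hx ?_
  have : X ⁻¹' {x} = ∅ := by
    ext ω
    simp only [Set.mem_preimage, Set.mem_singleton_iff, Set.mem_empty_iff_false, iff_false]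
    rintro rfl
    exact hxJ (hJ ω)
  simp [this, apply_empty hS]

theorem simpleInt_neg_one_smul (μ : Charge S) (X : Ω → ℝ) :
    simpleInt ((-1 : ℝ) • μ) X = -simpleInt μ X := by
  simp only [simpleInt, smul_toFun, ← finsum_neg_distrib]
  exact finsum_congr fun x => by ring

section ConvexRange

variable {P : Charge S}

theorem exists_subset_apply_eq (hPcr : HasConvexRange P) {A : Set Ω} (hA : A ∈ S) {t : ℝ}
    (ht : 0 ≤ t) (ht' : t ≤ P.toFun A) : ∃ B ∈ S, B ⊆ A ∧ P.toFun B = t := by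
  have : t ∈ {x : ℝ | ∃ B ∈ S, B ⊆ A ∧ P.toFun B = x} := hPcr A hA ▸ ⟨ht, ht'⟩
  exact this

theorem exists_half (hS : IsSetAlgebra S) (hP : IsProbCharge P) (hPcr : HasConvexRange P)
    (σ : Charge S) {A : Set Ω} (hA : A ∈ S) :
    ∃ B ∈ S, B ⊆ A ∧ P.toFun B = P.toFun A / 2 ∧ σ.toFun A / 2 ≤ σ.toFun B := by
  have h0 := hP.2 A
  obtain ⟨B, hB, hBA, hPB⟩ := exists_subset_apply_eq hPcr hA (t := P.toFun A / 2)
    (by linarith) (by linarith)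
  have h1 := P.apply_diff hS hA hB hBA
  have h2 := σ.apply_diff hS hA hB hBA
  rcases le_total (σ.toFun A / 2) (σ.toFun B) with h | h
  · exact ⟨B, hB, hBA, hPB, h⟩
  · exact ⟨A \ B, hS.sdiff_mem hA hB, Set.sdiff_subset, by linarith, by linarith⟩

/-- Within any set one can select a subset of prescribed `P`-measure carrying, up to `ε`, at least
its proportional share of a second charge. -/
theorem exists_subset_share_le (hS : IsSetAlgebra S) (hP : IsProbCharge P)
    (hPcr : HasConvexRange P) (σ : Charge S) {A : Set Ω} (hA : A ∈ S) {t : ℝ} (ht : 0 ≤ t)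
    (ht' : t ≤ P.toFun A) {ε : ℝ} (hε : 0 < ε) :
    ∃ B ∈ S, B ⊆ A ∧ P.toFun B = t ∧ t * σ.toFun A - ε ≤ P.toFun A * σ.toFun B := by
  obtain ⟨K, hK⟩ := σ.bounded
  set p := P.toFun A
  have hp0 : 0 ≤ p := hP.2 A
  have key : ∀ n : ℕ, ∀ t : ℝ, 0 ≤ t → t ≤ p → ∃ B ∈ S, B ⊆ A ∧ P.toFun B = t ∧
      t * σ.toFun A - 2 * p * K * (1 / 2) ^ n ≤ p * σ.toFun B := by
    intro n
    induction n with
    | zero =>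
      intro t ht ht'
      obtain ⟨B, hB, hBA, hPB⟩ := exists_subset_apply_eq hPcr hA ht ht'
      refine ⟨B, hB, hBA, hPB, ?_⟩
      have h1 := abs_le.1 (hK A)
      have h2 := abs_le.1 (hK B)
      nlinarith [mul_le_mul_of_nonneg_left h2.1 hp0, mul_le_mul_of_nonneg_left h1.2 ht,
        mul_le_mul_of_nonneg_right ht' ((abs_nonneg _).trans (hK A))]
    | succ n ih =>
      intro t ht ht'
      rw [pow_succ]
      rcases le_total (2 * t) p with h | h
      · obtain ⟨C, hC, hCA, hPC, hσC⟩ := ih (2 * t) (by linarith) h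
        obtain ⟨B, hB, hBC, hPB, hσB⟩ := exists_half hS hP hPcr σ hC
        refine ⟨B, hB, hBC.trans hCA, by linarith, ?_⟩
        have := mul_le_mul_of_nonneg_left hσB hp0
        linarith
      · obtain ⟨C, hC, hCA, hPC, hσC⟩ := ih (2 * t - p) (by linarith) (by linarith)
        have hAC := hS.sdiff_mem hA hC
        obtain ⟨B, hB, hBC, hPB, hσB⟩ := exists_half hS hP hPcr σ hAC
        have hd : Disjoint C B := Set.disjoint_sdiff_right.mono_right hBC
        refine ⟨C ∪ B, hS.union_mem hC hB, Set.union_subset hCA (hBC.trans Set.sdiff_subset),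
          ?_, ?_⟩
        · rw [P.additive _ _ hC hB hd, hPB, P.apply_diff hS hA hC hCA, hPC]
          linarith
        · rw [σ.additive _ _ hC hB hd]
          rw [σ.apply_diff hS hA hC hCA] at hσB
          have := mul_le_mul_of_nonneg_left hσB hp0
          linarith
  have hlim : Filter.Tendsto (fun n : ℕ => 2 * p * K * (1 / 2 : ℝ) ^ n) Filter.atTop
      (nhds 0) := by
    simpa using (tendsto_pow_atTop_nhds_zero_of_lt_one (r := (1 / 2 : ℝ)) (by norm_num)
      (by norm_num)).const_mul (2 * p * K)
  obtain ⟨n, hn⟩ := (hlim.eventually_lt_const hε).exists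
  obtain ⟨B, hB, hBA, hPB, h⟩ := key n t ht ht'
  exact ⟨B, hB, hBA, hPB, by linarith⟩

open Classical in
/-- A distribution of total mass `P B` is realised on `B` by a simple function whose integral
against `σ` is, up to `ε`, at least its integral against the multiple of `P` having the same mass
as `σ` on `B`. -/
theorem exists_rearrangement (hS : IsSetAlgebra S) (hP : IsProbCharge P)
    (hPcr : HasConvexRange P) (σ : Charge S) (J : Finset ℝ) :
    ∀ B ∈ S, 0 < P.toFun B → ∀ w : ℝ → ℝ, (∀ x ∈ J, 0 ≤ w x) → ∑ x ∈ J, w x = P.toFun B →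
      ∀ ε > 0, ∃ Z : Ω → ℝ, (∀ ω ∈ B, Z ω ∈ J) ∧ (∀ x, B ∩ Z ⁻¹' {x} ∈ S) ∧
        (∀ x ∈ J, P.toFun (B ∩ Z ⁻¹' {x}) = w x) ∧
        σ.toFun B * (∑ x ∈ J, x * w x) - ε ≤
          P.toFun B * ∑ x ∈ J, x * σ.toFun (B ∩ Z ⁻¹' {x}) := by
  induction J using Finset.induction_on with
  | empty =>
    intro B hB hPB w _ hw
    simp at hw
    linarith
  | insert a J ha ih =>
    intro B hB hPB w hw0 hw ε hε
    have hJ0 : ∀ x ∈ J, 0 ≤ w x := fun x hx => hw0 x (Finset.mem_insert_of_mem hx)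
    rw [Finset.sum_insert ha] at hw
    have ha0 := hw0 a (Finset.mem_insert_self a J)
    have hne : ∀ x ∈ J, x ≠ a := fun x hx h => ha (h ▸ hx)
    rcases (Finset.sum_nonneg hJ0).eq_or_lt with h0 | hpos
    · have hz := (Finset.sum_eq_zero_iff_of_nonneg hJ0).1 h0.symm
      have hfib : ∀ x, x ≠ a → B ∩ (fun _ : Ω => a) ⁻¹' {x} = ∅ := fun x hx => by
        ext ω
        simp [hx.symm]
      have hfa : B ∩ (fun _ : Ω => a) ⁻¹' {a} = B := by
        ext ω
        simp
      refine ⟨fun _ => a, by simp, fun x => ?_, fun x hx => ?_, ?_⟩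
      · by_cases hx : x = a
        · rwa [hx, hfa]
        · rw [hfib x hx]
          exact hS.empty_mem
      · rcases Finset.mem_insert.1 hx with rfl | hx
        · rw [hfa]
          linarith
        · rw [hfib x (hne x hx), apply_empty hS, hz x hx]
      · rw [Finset.sum_insert ha, Finset.sum_insert ha, hfa,
          Finset.sum_eq_zero (s := J) fun x hx => by rw [hz x hx, mul_zero],
          Finset.sum_eq_zero (s := J) fun x hx => by
            rw [hfib x (hne x hx), apply_empty hS, mul_zero]]
        have : w a = P.toFun B := by linarith
        rw [this]
        linarith
    · set q := ∑ x ∈ J, w x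
      set W := ∑ x ∈ J, x * w x
      obtain ⟨C, hC, hCB, hPC, hσC⟩ := exists_subset_share_le hS hP hPcr ((a - W / q) • σ) hB
        ha0 (by linarith) (half_pos hε)
      have hBC := hS.sdiff_mem hB hC
      have hPBC : P.toFun (B \ C) = q := by
        rw [P.apply_diff hS hB hC hCB]
        linarith
      obtain ⟨Z, hZJ, hZS, hZP, hZσ⟩ := ih (B \ C) hBC (hPBC ▸ hpos) w hJ0 (by rw [hPBC])
        (ε * q / (2 * P.toFun B)) (by positivity)
      have hfib : ∀ x, x ≠ a →
          B ∩ (fun ω => if ω ∈ C then a else Z ω) ⁻¹' {x} = (B \ C) ∩ Z ⁻¹' {x} := by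
        intro x hx
        ext ω
        by_cases hω : ω ∈ C <;> simp [hω, hx.symm]
      have hfa : B ∩ (fun ω => if ω ∈ C then a else Z ω) ⁻¹' {a} = C := by
        ext ω
        by_cases hω : ω ∈ C
        · simp [hω, hCB hω]
        · simp only [Set.mem_inter_iff, Set.mem_preimage, hω, if_false,
            Set.mem_singleton_iff, iff_false, not_and]
          exact fun hωB => hne _ (hZJ ω ⟨hωB, hω⟩)
      refine ⟨fun ω => if ω ∈ C then a else Z ω, fun ω hω => ?_, fun x => ?_, fun x hx => ?_, ?_⟩
      · by_cases hωC : ω ∈ C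
        · simp [hωC]
        · simp [hωC, hZJ ω ⟨hω, hωC⟩]
      · by_cases hx : x = a
        · rwa [hx, hfa]
        · rw [hfib x hx]
          exact hZS x
      · rcases Finset.mem_insert.1 hx with rfl | hx
        · rw [hfa, hPC]
        · rw [hfib x (hne x hx), hZP x hx]
      · have hsum : ∑ x ∈ J, x * σ.toFun (B ∩ (fun ω => if ω ∈ C then a else Z ω) ⁻¹' {x}) =
            ∑ x ∈ J, x * σ.toFun ((B \ C) ∩ Z ⁻¹' {x}) :=
          Finset.sum_congr rfl fun x hx => by rw [hfib x (hne x hx)]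
        rw [Finset.sum_insert ha, Finset.sum_insert ha, hfa, hsum]
        rw [hPBC, σ.apply_diff hS hB hC hCB] at hZσ
        simp only [smul_toFun] at hσC
        set p := P.toFun B
        set T := ∑ x ∈ J, x * σ.toFun ((B \ C) ∩ Z ⁻¹' {x})
        have hT : p * ((σ.toFun B - σ.toFun C) * (W / q)) - ε / 2 ≤ p * T := by
          have := mul_le_mul_of_nonneg_left hZσ (div_pos hPB hpos).le
          calc _ = p / q * ((σ.toFun B - σ.toFun C) * W - ε * q / (2 * p)) := by
                field_simp
            _ ≤ p / q * (q * T) := this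
            _ = p * T := by field_simp
        have hWq : W = q * (W / q) := by field_simp
        have hpq : p = w a + q := hw.symm
        have e : σ.toFun B * (a * w a + W) =
            w a * ((a - W / q) * σ.toFun B) + p * (σ.toFun B * (W / q)) := by
          rw [hpq]
          linear_combination σ.toFun B * hWq
        rw [e]
        linarith

variable {D : Set (Ω → ℝ)} {φ : (Ω → ℝ) → ℝ}

open Classical in
/-- Changing a member of a `P`-invariant set on a `P`-null set arbitrarily shows that a supporting
charge vanishes on that null set. -/
theorem apply_eq_zero_of_null (hS : IsSetAlgebra S) (hP : IsProbCharge P)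
    (hne : D.Nonempty) (hDsimple : ∀ X ∈ D, IsSimpleRV S X)
    (hDinv : ∀ X ∈ D, ∀ Y : Ω → ℝ, IsSimpleRV S Y →
      (∀ x : ℝ, P.toFun (X ⁻¹' {x}) = P.toFun (Y ⁻¹' {x})) → Y ∈ D)
    (hφinv : ∀ X ∈ D, ∀ Y ∈ D,
      (∀ x : ℝ, P.toFun (X ⁻¹' {x}) = P.toFun (Y ⁻¹' {x})) → φ X = φ Y)
    {μ : Charge S} (hμ : ∀ X ∈ D, simpleInt μ X ≤ φ X) {N : Set Ω} (hN : N ∈ S)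
    (hPN : P.toFun N = 0) : μ.toFun N = 0 := by
  obtain ⟨X, hX⟩ := hne
  obtain ⟨hfin, hmem⟩ := hDsimple X hX
  set J := hfin.toFinset
  have hJ : ∀ ω, X ω ∈ J := fun ω => by simp [J]
  set M := ∑ x ∈ J, x * μ.toFun (X ⁻¹' {x} \ N)
  have key : ∀ c : ℝ, M + c * μ.toFun N ≤ φ X := by
    intro c
    set Y : Ω → ℝ := fun ω => if ω ∈ N then c else X ω with hY
    have hYK : ∀ ω, Y ω ∈ insert c J := fun ω => by
      by_cases hω : ω ∈ N <;> simp [hY, hω, hJ]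
    have hfib : ∀ x, Y ⁻¹' {x} = (X ⁻¹' {x} \ N) ∪ (if x = c then N else ∅) := by
      intro x
      ext ω
      by_cases hω : ω ∈ N <;> by_cases hx : x = c <;> simp [hY, hω, hx, eq_comm (a := c)]
    have hXN : ∀ x, X ⁻¹' {x} \ N ∈ S := fun x => hS.sdiff_mem (hmem x) hN
    have hNS : ∀ x : ℝ, (if x = c then N else ∅) ∈ S := fun x => by
      split_ifs
      exacts [hN, hS.empty_mem]
    have hadd : ∀ (ν : Charge S) (x : ℝ), ν.toFun (Y ⁻¹' {x}) =
        ν.toFun (X ⁻¹' {x} \ N) + if x = c then ν.toFun N else 0 := by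
      intro ν x
      rw [hfib, ν.additive _ _ (hXN x) (hNS x)]
      · split_ifs <;> simp [apply_empty hS]
      · split_ifs
        · exact Set.disjoint_sdiff_left
        · simp
    have hYsimple : IsSimpleRV S Y := by
      refine ⟨(Finset.finite_toSet (insert c J)).subset ?_, fun x => ?_⟩
      · rintro _ ⟨ω, rfl⟩
        exact hYK ω
      · rw [hfib]
        exact hS.union_mem (hXN x) (hNS x)
    have heq : ∀ x, P.toFun (X ⁻¹' {x}) = P.toFun (Y ⁻¹' {x}) := by
      intro x
      have h1 := P.apply_inter_add_diff hS hN (hmem x)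
      have h2 := P.apply_inter_add_diff hS (hmem x) hN
      have h3 := hP.2 (N ∩ X ⁻¹' {x})
      have h4 := hP.2 (N \ X ⁻¹' {x})
      rw [Set.inter_comm] at h2
      rw [hadd, hPN, ite_self]
      linarith
    have hYD := hDinv X hX Y hYsimple heq
    rw [hφinv X hX Y hYD heq]
    refine le_trans (le_of_eq ?_) (hμ Y hYD)
    rw [simpleInt_eq_sum hS μ _ hYK]
    simp only [hadd, mul_add, Finset.sum_add_distrib, mul_ite, mul_zero]
    rw [Finset.sum_ite_eq' (insert c J) c (fun x => x * μ.toFun N),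
      if_pos (Finset.mem_insert_self c J)]
    congr 1
    refine Finset.sum_subset (Finset.subset_insert c J) fun x _ hx => ?_
    have : X ⁻¹' {x} \ N = ∅ := by
      ext ω
      simp only [Set.mem_sdiff, Set.mem_preimage, Set.mem_singleton_iff,
        Set.mem_empty_iff_false, iff_false, not_and]
      rintro rfl
      exact absurd (hJ ω) hx
    rw [this, apply_empty hS, mul_zero]
  by_contra h
  have := key ((φ X - M + 1) / μ.toFun N)
  rw [div_mul_cancel₀ _ h] at this
  linarith

/-- The charge obtained from `μ` by exchanging its masses on `A` and `B` and spreading them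
proportionally to `P` there. -/
noncomputable def exchange (hS : IsSetAlgebra S) (P μ : Charge S) (A B : Set Ω) (hA : A ∈ S)
    (hB : B ∈ S) : Charge S :=
  (μ.toFun B / P.toFun A) • P.restrict hS A hA + (μ.toFun A / P.toFun B) • P.restrict hS B hB +
    μ.restrict hS (A ∪ B)ᶜ (hS.compl_mem (hS.union_mem hA hB))

open Classical in
theorem simpleInt_exchange_le (hS : IsSetAlgebra S) (hP : IsProbCharge P)
    (hPcr : HasConvexRange P) (hDsimple : ∀ X ∈ D, IsSimpleRV S X)
    (hDinv : ∀ X ∈ D, ∀ Y : Ω → ℝ, IsSimpleRV S Y →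
      (∀ x : ℝ, P.toFun (X ⁻¹' {x}) = P.toFun (Y ⁻¹' {x})) → Y ∈ D)
    (hφinv : ∀ X ∈ D, ∀ Y ∈ D,
      (∀ x : ℝ, P.toFun (X ⁻¹' {x}) = P.toFun (Y ⁻¹' {x})) → φ X = φ Y)
    {μ : Charge S} (hμ : ∀ X ∈ D, simpleInt μ X ≤ φ X) {A B : Set Ω} (hA : A ∈ S) (hB : B ∈ S)
    (hAB : Disjoint A B) (hPA : 0 < P.toFun A) (hPAB : P.toFun A = P.toFun B) :
    ∀ X ∈ D, simpleInt (exchange hS P μ A B hA hB) X ≤ φ X := by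
  intro X hX
  obtain ⟨hfin, hmem⟩ := hDsimple X hX
  set J := hfin.toFinset
  have hJ : ∀ ω, X ω ∈ J := fun ω => by simp [J]
  have hPB : 0 < P.toFun B := hPAB ▸ hPA
  have hXA : ∀ x, A ∩ X ⁻¹' {x} ∈ S := fun x => hS.inter_mem hA (hmem x)
  have hXB : ∀ x, B ∩ X ⁻¹' {x} ∈ S := fun x => hS.inter_mem hB (hmem x)
  have hU : (A ∪ B)ᶜ ∈ S := hS.compl_mem (hS.union_mem hA hB)
  have hXU : ∀ x, (A ∪ B)ᶜ ∩ X ⁻¹' {x} ∈ S := fun x => hS.inter_mem hU (hmem x)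
  have hglue : ∀ (ν : Charge S) (Y : Ω → ℝ) (x : ℝ), A ∩ Y ⁻¹' {x} ∈ S → B ∩ Y ⁻¹' {x} ∈ S →
      (A ∪ B)ᶜ ∩ Y ⁻¹' {x} ∈ S → Y ⁻¹' {x} ∈ S ∧ ν.toFun (Y ⁻¹' {x}) =
        ν.toFun (A ∩ Y ⁻¹' {x}) + ν.toFun (B ∩ Y ⁻¹' {x}) +
          ν.toFun ((A ∪ B)ᶜ ∩ Y ⁻¹' {x}) := by
    intro ν Y x h1 h2 h3
    have hdecomp : Y ⁻¹' {x} = (A ∩ Y ⁻¹' {x} ∪ B ∩ Y ⁻¹' {x}) ∪ (A ∪ B)ᶜ ∩ Y ⁻¹' {x} := by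
      ext ω
      simp
      tauto
    constructor
    · rw [hdecomp]
      exact hS.union_mem (hS.union_mem h1 h2) h3
    · conv_lhs => rw [hdecomp]
      rw [ν.additive _ _ (hS.union_mem h1 h2) h3, ν.additive _ _ h1 h2]
      · exact hAB.mono Set.inter_subset_left Set.inter_subset_left
      · rw [← Set.union_inter_distrib_right]
        exact (disjoint_compl_right).mono Set.inter_subset_left Set.inter_subset_left
  have hsumA := P.sum_apply_inter_fiber hS X hXA J fun ω _ => hJ ω
  have hsumB := P.sum_apply_inter_fiber hS X hXB J fun ω _ => hJ ω
  refine le_of_forall_pos_le_add fun ε hε => ?_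
  obtain ⟨Z₁, hZ₁J, hZ₁S, hZ₁P, hZ₁μ⟩ := exists_rearrangement hS hP hPcr μ J A hA hPA
    (fun x => P.toFun (B ∩ X ⁻¹' {x})) (fun x _ => hP.2 _) (by rw [hsumB, hPAB])
    (P.toFun A * (ε / 2)) (by positivity)
  obtain ⟨Z₂, hZ₂J, hZ₂S, hZ₂P, hZ₂μ⟩ := exists_rearrangement hS hP hPcr μ J B hB hPB
    (fun x => P.toFun (A ∩ X ⁻¹' {x})) (fun x _ => hP.2 _) (by rw [hsumA, hPAB])
    (P.toFun B * (ε / 2)) (by positivity)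
  set Z : Ω → ℝ := fun ω => if ω ∈ A then Z₁ ω else if ω ∈ B then Z₂ ω else X ω with hZ
  have hZA : ∀ x, A ∩ Z ⁻¹' {x} = A ∩ Z₁ ⁻¹' {x} := fun x => by
    ext ω
    by_cases h : ω ∈ A <;> simp [hZ, h]
  have hZB : ∀ x, B ∩ Z ⁻¹' {x} = B ∩ Z₂ ⁻¹' {x} := fun x => by
    ext ω
    by_cases h : ω ∈ B
    · simp [hZ, h, Set.disjoint_right.1 hAB h]
    · simp [h]
  have hZU : ∀ x, (A ∪ B)ᶜ ∩ Z ⁻¹' {x} = (A ∪ B)ᶜ ∩ X ⁻¹' {x} := fun x => by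
    ext ω
    by_cases h : ω ∈ A <;> by_cases h' : ω ∈ B <;> simp [hZ, h, h']
  have hZJ : ∀ ω, Z ω ∈ J := fun ω => by
    by_cases h : ω ∈ A
    · simpa [hZ, h] using hZ₁J ω h
    · by_cases h' : ω ∈ B
      · simpa [hZ, h, h'] using hZ₂J ω h'
      · simpa [hZ, h, h'] using hJ ω
  have hZglue := fun (ν : Charge S) (x : ℝ) => hglue ν Z x (by rw [hZA]; exact hZ₁S x)
    (by rw [hZB]; exact hZ₂S x) (by rw [hZU]; exact hXU x)
  simp only [hZA, hZB, hZU] at hZglue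
  have hZsimple : IsSimpleRV S Z := by
    refine ⟨J.finite_toSet.subset ?_, fun x => (hZglue P x).1⟩
    rintro _ ⟨ω, rfl⟩
    exact hZJ ω
  have heq : ∀ x, P.toFun (X ⁻¹' {x}) = P.toFun (Z ⁻¹' {x}) := by
    intro x
    by_cases hx : x ∈ J
    · rw [(hZglue P x).2, (hglue P X x (hXA x) (hXB x) (hXU x)).2, hZ₁P x hx, hZ₂P x hx]
      ring
    · have hempty : ∀ Y : Ω → ℝ, (∀ ω, Y ω ∈ J) → Y ⁻¹' {x} = ∅ := by
        intro Y hY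
        ext ω
        simp only [Set.mem_preimage, Set.mem_singleton_iff, Set.mem_empty_iff_false, iff_false]
        rintro rfl
        exact hx (hY ω)
      rw [hempty X hJ, hempty Z hZJ]
  have hZD := hDinv X hX Z hZsimple heq
  have hle := hμ Z hZD
  rw [← hφinv X hX Z hZD heq, simpleInt_eq_sum hS μ J hZJ] at hle
  simp only [fun x => (hZglue μ x).2, mul_add, Finset.sum_add_distrib] at hle
  have hexch : ∀ x, (exchange hS P μ A B hA hB).toFun (X ⁻¹' {x}) =
      μ.toFun B / P.toFun A * P.toFun (A ∩ X ⁻¹' {x}) +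
        μ.toFun A / P.toFun B * P.toFun (B ∩ X ⁻¹' {x}) +
          μ.toFun ((A ∪ B)ᶜ ∩ X ⁻¹' {x}) := by
    intro x
    simp only [exchange, add_toFun, smul_toFun, restrict_apply hS _ _ (hmem x),
      Set.inter_comm (X ⁻¹' {x})]
  rw [simpleInt_eq_sum hS _ J hJ]
  simp only [hexch, mul_add, Finset.sum_add_distrib, mul_left_comm _ (_ / _ : ℝ)]
  rw [← Finset.mul_sum, ← Finset.mul_sum]
  have e₁ : μ.toFun A / P.toFun B * (∑ x ∈ J, x * P.toFun (B ∩ X ⁻¹' {x})) - ε / 2 ≤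
      ∑ x ∈ J, x * μ.toFun (A ∩ Z₁ ⁻¹' {x}) := by
    rw [← hPAB]
    refine le_of_mul_le_mul_left (le_trans (le_of_eq ?_) hZ₁μ) hPA
    field_simp
  have e₂ : μ.toFun B / P.toFun A * (∑ x ∈ J, x * P.toFun (A ∩ X ⁻¹' {x})) - ε / 2 ≤
      ∑ x ∈ J, x * μ.toFun (B ∩ Z₂ ⁻¹' {x}) := by
    rw [hPAB]
    refine le_of_mul_le_mul_left (le_trans (le_of_eq ?_) hZ₂μ) hPB
    field_simp
  linarith

theorem apply_le_of_isLUB (hS : IsSetAlgebra S) (hP : IsProbCharge P)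
    (hPcr : HasConvexRange P) (hne : D.Nonempty) (hDsimple : ∀ X ∈ D, IsSimpleRV S X)
    (hDinv : ∀ X ∈ D, ∀ Y : Ω → ℝ, IsSimpleRV S Y →
      (∀ x : ℝ, P.toFun (X ⁻¹' {x}) = P.toFun (Y ⁻¹' {x})) → Y ∈ D)
    (hφinv : ∀ X ∈ D, ∀ Y ∈ D,
      (∀ x : ℝ, P.toFun (X ⁻¹' {x}) = P.toFun (Y ⁻¹' {x})) → φ X = φ Y)
    {s : Charge S} (hs : s ∈ upperBounds {μ : Charge S | ∀ X ∈ D, simpleInt μ X ≤ φ X})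
    {μ : Charge S} (hμ : ∀ X ∈ D, simpleInt μ X ≤ φ X) {A B : Set Ω} (hA : A ∈ S) (hB : B ∈ S)
    (hPAB : P.toFun A = P.toFun B) : μ.toFun B ≤ s.toFun A := by
  have hAB := hS.sdiff_mem hA hB
  have hBA := hS.sdiff_mem hB hA
  have hPA := P.apply_inter_add_diff hS hA hB
  have hPB := P.apply_inter_add_diff hS hB hA
  have hsA := s.apply_inter_add_diff hS hA hB
  have hμB := μ.apply_inter_add_diff hS hB hA
  rw [Set.inter_comm] at hPB hμB
  have hle := hs hμ
  have hdiff : μ.toFun (B \ A) ≤ s.toFun (A \ B) := by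
    rcases (hP.2 (A \ B)).eq_or_lt with h0 | hpos
    · have hnull := fun {N : Set Ω} (hN : N ∈ S) (hPN : P.toFun N = 0) =>
        apply_eq_zero_of_null hS hP hne hDsimple hDinv hφinv hμ hN hPN
      have h1 := hle _ hAB
      rw [hnull hAB h0.symm] at h1
      rwa [hnull hBA (by linarith)]
    · have hd : Disjoint (A \ B) (B \ A) := disjoint_sdiff_sdiff
      have h1 := hs (simpleInt_exchange_le hS hP hPcr hDsimple hDinv hφinv hμ hAB hBA hd hpos
        (by linarith)) _ hAB
      simp only [exchange, add_toFun, smul_toFun, restrict_apply hS _ _ hAB, Set.inter_self,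
        hd.inter_eq, apply_empty hS] at h1
      rw [Set.disjoint_iff_inter_eq_empty.1 (disjoint_compl_right.mono_left Set.subset_union_left),
        apply_empty hS, div_mul_cancel₀ _ hpos.ne'] at h1
      linarith
  linarith [hle _ (hS.inter_mem hA hB)]

/-- The supremum of the lower supporting charges is a multiple of `P`. -/
theorem eq_smul_of_isLUB (hS : IsSetAlgebra S) (hP : IsProbCharge P)
    (hPcr : HasConvexRange P) (hne : D.Nonempty) (hDsimple : ∀ X ∈ D, IsSimpleRV S X)
    (hDinv : ∀ X ∈ D, ∀ Y : Ω → ℝ, IsSimpleRV S Y →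
      (∀ x : ℝ, P.toFun (X ⁻¹' {x}) = P.toFun (Y ⁻¹' {x})) → Y ∈ D)
    (hφinv : ∀ X ∈ D, ∀ Y ∈ D,
      (∀ x : ℝ, P.toFun (X ⁻¹' {x}) = P.toFun (Y ⁻¹' {x})) → φ X = φ Y)
    {s : Charge S} (hs : IsLUB {μ : Charge S | ∀ X ∈ D, simpleInt μ X ≤ φ X} s) :
    s = s.toFun Set.univ • P := by
  have hub : s ≤ s.toFun Set.univ • P := by
    refine hs.2 fun μ hμ E hE => le_of_forall_pos_le_add fun ε hε => ?_
    have hPE : P.toFun E ≤ P.toFun Set.univ := by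
      linarith [P.apply_add_compl hS hE, hP.2 Eᶜ]
    obtain ⟨C, hC, -, hPC, hsC⟩ := exists_subset_share_le hS hP hPcr ((-1 : ℝ) • s)
      hS.univ_mem (hP.2 E) hPE hε
    have := apply_le_of_isLUB hS hP hPcr hne hDsimple hDinv hφinv hs.1 hμ hC hE hPC
    rw [hP.1] at hsC
    simp only [smul_toFun] at hsC ⊢
    linarith
  refine le_antisymm hub fun E hE => ?_
  have h1 := hub _ (hS.compl_mem hE)
  have h2 := s.apply_add_compl hS hE
  have h3 := P.apply_add_compl hS hE
  rw [hP.1] at h3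
  simp only [smul_toFun] at h1 ⊢
  have h4 : P.toFun Eᶜ = 1 - P.toFun E := by linarith
  rw [h4] at h1
  linarith

end ConvexRange

end Charge

/-- Let `P` be a convex-ranged probability charge on an algebra `S`, `D` a
nonempty `P`-invariant set of simple random variables and `φ : D → ℝ` `P`-invariant. If the
supremum of the lower supporting set `L^f` exists in `ba` (setwise order), it is a scalar
multiple of `P`; if the infimum of the upper supporting set `U^f` exists, it is a scalar
multiple of `P`. -/
theorem stmt4 {Ω : Type*} (S : Set (Set Ω)) (hS : MeasureTheory.IsSetAlgebra S)
    (P : Charge S) (hP : IsProbCharge P) (hPcr : HasConvexRange P)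
    (D : Set (Ω → ℝ)) (hne : D.Nonempty) (hDsimple : ∀ X ∈ D, IsSimpleRV S X)
    (hDinv : ∀ X ∈ D, ∀ Y : Ω → ℝ, IsSimpleRV S Y →
      (∀ x : ℝ, P.toFun (X ⁻¹' {x}) = P.toFun (Y ⁻¹' {x})) → Y ∈ D)
    (φ : (Ω → ℝ) → ℝ)
    (hφinv : ∀ X ∈ D, ∀ Y ∈ D,
      (∀ x : ℝ, P.toFun (X ⁻¹' {x}) = P.toFun (Y ⁻¹' {x})) → φ X = φ Y) :
    (∀ s : Charge S,
      IsLUB {μ : Charge S | ∀ X ∈ D, simpleInt μ X ≤ φ X} s → ∃ a : ℝ, s = a • P) ∧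
    (∀ s : Charge S,
      IsGLB {μ : Charge S | ∀ X ∈ D, φ X ≤ simpleInt μ X} s → ∃ b : ℝ, s = b • P) := by
  refine ⟨fun s hs => ⟨_, Charge.eq_smul_of_isLUB hS hP hPcr hne hDsimple hDinv hφinv hs⟩,
    fun s hs => ?_⟩
  have hneg : IsLUB {μ : Charge S | ∀ X ∈ D, simpleInt μ X ≤ -φ X} ((-1 : ℝ) • s) := by
    refine ⟨fun μ hμ A hA => ?_, fun ν hν A hA => ?_⟩
    · have := hs.1 (show (-1 : ℝ) • μ ∈ {μ : Charge S | ∀ X ∈ D, φ X ≤ simpleInt μ X} from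
        fun X hX => by
          rw [Charge.simpleInt_neg_one_smul]
          linarith [hμ X hX]) A hA
      simp only [Charge.smul_toFun] at this ⊢
      linarith
    · have hlb : (-1 : ℝ) • ν ∈ lowerBounds {μ : Charge S | ∀ X ∈ D, φ X ≤ simpleInt μ X} := by
        intro μ hμ E hE
        have := hν (show (-1 : ℝ) • μ ∈ {μ : Charge S | ∀ X ∈ D, simpleInt μ X ≤ -φ X} from
          fun X hX => by
            rw [Charge.simpleInt_neg_one_smul]
            linarith [hμ X hX]) E hE
        simp only [Charge.smul_toFun] at this ⊢
        linarith
      have := hs.2 hlb A hA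
      simp only [Charge.smul_toFun] at this ⊢
      linarith
  have h := Charge.eq_smul_of_isLUB hS hP hPcr hne hDsimple hDinv
    (fun X hX Y hY hXY => congrArg Neg.neg (hφinv X hX Y hY hXY)) hneg
  refine ⟨s.toFun Set.univ, Charge.ext' (funext fun A => ?_)⟩
  have hA := congrFun (congrArg Charge.toFun h) A
  simp only [Charge.smul_toFun] at hA ⊢
  linarith
end

section
/- Let Σ be a σ-algebra, ℙ an atomless probability measure on Σ, and v a ℙ-invariant game on Σ. (i) For Y ∈ {A_v, LA_v} (anticore and loose anticore) with corresponding σ-version Y^σ: sup Y exists in ba if and only if sup Y^σ exists in ca, and in that case there is a constant a ∈ ℝ with a·ℙ = sup Y = sup Y^σ. (ii) For Y ∈ {C_v, LC_v} (core and loose core) with corresponding σ-version Y^σ: inf Y exists in ba if and only if inf Y^σ exists in ca, and in that case there is a constant b ∈ ℝ with b·ℙ = inf Y = inf Y^σ. -/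
/-- The measurable sets of a measurable space, as a set algebra. -/
def MSets (Ω : Type*) [MeasurableSpace Ω] : Set (Set Ω) := {A : Set Ω | MeasurableSet A}

/-- A charge is countably additive if it is σ-additive on pairwise disjoint sequences of
members of `S`. -/
def CountablyAdditive {Ω : Type*} {S : Set (Set Ω)} (μ : Charge S) : Prop :=
  ∀ f : ℕ → Set Ω, (∀ n, f n ∈ S) → (Pairwise fun m n => Disjoint (f m) (f n)) →
    (⋃ n, f n) ∈ S → HasSum (fun n => μ.toFun (f n)) (μ.toFun (⋃ n, f n))

/-- Atomlessness of a nonnegative charge. -/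
def AtomlessCharge {Ω : Type*} {S : Set (Set Ω)} (P : Charge S) : Prop :=
  ∀ A ∈ S, 0 < P.toFun A → ∃ B ∈ S, B ⊆ A ∧ 0 < P.toFun B ∧ P.toFun B < P.toFun A

/-- Sup-transfer property between `ba` and `ca`: the supremum of `Y` exists in `ba` iff the
supremum of its countably additive part exists in `ca`; in that case both are equal to a
scalar multiple of `P` and lie in `ca`. -/
def SupTransfer {Ω : Type*} {S : Set (Set Ω)} (Y : Set (Charge S)) (P : Charge S) : Prop :=
  ((∃ s : Charge S, IsLUB Y s) ↔
    (∃ s : {μ : Charge S // CountablyAdditive μ},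
      IsLUB {ν : {μ : Charge S // CountablyAdditive μ} | ν.1 ∈ Y} s)) ∧
  ∀ s : Charge S, IsLUB Y s → ∃ a : ℝ, s = a • P ∧
    ∃ hs : CountablyAdditive s,
      IsLUB {ν : {μ : Charge S // CountablyAdditive μ} | ν.1 ∈ Y} ⟨s, hs⟩

/-- Inf-transfer property between `ba` and `ca`, analogous to `SupTransfer`. -/
def InfTransfer {Ω : Type*} {S : Set (Set Ω)} (Y : Set (Charge S)) (P : Charge S) : Prop :=
  ((∃ s : Charge S, IsGLB Y s) ↔
    (∃ s : {μ : Charge S // CountablyAdditive μ},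
      IsGLB {ν : {μ : Charge S // CountablyAdditive μ} | ν.1 ∈ Y} s)) ∧
  ∀ s : Charge S, IsGLB Y s → ∃ b : ℝ, s = b • P ∧
    ∃ hs : CountablyAdditive s,
      IsGLB {ν : {μ : Charge S // CountablyAdditive μ} | ν.1 ∈ Y} ⟨s, hs⟩

namespace Charge

section Algebra

variable {Ω : Type*} [MeasurableSpace Ω]

theorem toFun_empty (μ : Charge (MSets Ω)) : μ.toFun ∅ = 0 := by
  have h := μ.additive ∅ ∅ MeasurableSet.empty MeasurableSet.empty (Set.disjoint_empty _)
  rw [Set.union_empty] at h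
  linarith

theorem toFun_inter_add_diff (μ : Charge (MSets Ω)) {A B : Set Ω} (hA : MeasurableSet A)
    (hB : MeasurableSet B) : μ.toFun (A ∩ B) + μ.toFun (A \ B) = μ.toFun A := by
  rw [← μ.additive _ _ (hA.inter hB) (hA.diff hB) Set.disjoint_sdiff_inter.symm,
    Set.inter_union_sdiff]

theorem toFun_diff (μ : Charge (MSets Ω)) {A B : Set Ω} (hA : MeasurableSet A)
    (hB : MeasurableSet B) (h : B ⊆ A) : μ.toFun (A \ B) = μ.toFun A - μ.toFun B := by
  have := μ.toFun_inter_add_diff hA hB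
  rw [Set.inter_eq_self_of_subset_right h] at this
  linarith

theorem toFun_add_compl (μ : Charge (MSets Ω)) {A : Set Ω} (hA : MeasurableSet A) :
    μ.toFun A + μ.toFun Aᶜ = μ.toFun Set.univ := by
  have := μ.toFun_inter_add_diff MeasurableSet.univ hA
  rwa [Set.univ_inter, ← Set.compl_eq_univ_sdiff] at this

theorem neg_one_smul_neg_one_smul (μ : Charge (MSets Ω)) : (-1 : ℝ) • (-1 : ℝ) • μ = μ :=
  ext' (funext fun A => by simp)

theorem neg_one_smul_antitone : Antitone fun μ : Charge (MSets Ω) => (-1 : ℝ) • μ := by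
  intro μ ν h A hA
  have := h A hA
  simp only [smul_toFun]
  linarith

theorem _root_.CountablyAdditive.smul {μ : Charge (MSets Ω)} (hμ : CountablyAdditive μ) (a : ℝ) :
    CountablyAdditive (a • μ) :=
  fun f hf hd hU => (hμ f hf hd hU).mul_left a

theorem toFun_mono {P : Charge (MSets Ω)} (hP : IsProbCharge P) {A B : Set Ω}
    (hA : MeasurableSet A) (hB : MeasurableSet B) (h : A ⊆ B) : P.toFun A ≤ P.toFun B := by
  have := P.toFun_diff hB hA h
  linarith [hP.2 (B \ A)]

/-- A countably additive charge as a real-valued vector measure. -/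
def toVectorMeasure (μ : Charge (MSets Ω)) (hμ : CountablyAdditive μ) :
    MeasureTheory.VectorMeasure Ω ℝ where
  measureOf' := μ.toFun
  empty' := μ.toFun_empty
  not_measurable' A hA := μ.zero_of_not_mem A hA
  m_iUnion' f hf hd := hμ f hf hd (MeasurableSet.iUnion hf)

theorem tendsto_toFun_iUnion {μ : Charge (MSets Ω)} (hμ : CountablyAdditive μ) {f : ℕ → Set Ω}
    (hf : ∀ n, MeasurableSet (f n)) (hmono : Monotone f) :
    Filter.Tendsto (fun n => μ.toFun (f n)) Filter.atTop (nhds (μ.toFun (⋃ n, f n))) :=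
  (μ.toVectorMeasure hμ).tendsto_vectorMeasure_iUnion_atTop_nat hmono hf

end Algebra

section ConvexRange

variable {Ω : Type*} [MeasurableSpace Ω] {P : Charge (MSets Ω)}

theorem exists_subset_toFun_pos_le_pow (hP : IsProbCharge P) (hat : AtomlessCharge P) {A : Set Ω}
    (hA : MeasurableSet A) (hpos : 0 < P.toFun A) (n : ℕ) :
    ∃ B, MeasurableSet B ∧ B ⊆ A ∧ 0 < P.toFun B ∧ P.toFun B ≤ (1 / 2) ^ n := by
  induction n with
  | zero =>
    refine ⟨A, hA, subset_rfl, hpos, ?_⟩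
    have := toFun_mono hP hA MeasurableSet.univ (Set.subset_univ A)
    simpa [hP.1] using this
  | succ n ih =>
    obtain ⟨B, hB, hBA, hB0, hBn⟩ := ih
    obtain ⟨E, hE, hEB, hE0, hElt⟩ := hat B hB hB0
    have hd := P.toFun_diff hB hE hEB
    rcases le_total (P.toFun E) (P.toFun B / 2) with h | h
    · exact ⟨E, hE, hEB.trans hBA, hE0, by rw [pow_succ]; linarith⟩
    · exact ⟨B \ E, hB.diff hE, Set.sdiff_subset.trans hBA, by linarith,
        by rw [pow_succ]; linarith⟩

theorem exists_subset_toFun_pos_lt (hP : IsProbCharge P) (hat : AtomlessCharge P) {A : Set Ω}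
    (hA : MeasurableSet A) (hpos : 0 < P.toFun A) {ε : ℝ} (hε : 0 < ε) :
    ∃ B, MeasurableSet B ∧ B ⊆ A ∧ 0 < P.toFun B ∧ P.toFun B < ε := by
  obtain ⟨n, hn⟩ := exists_pow_lt_of_lt_one hε (by norm_num : (1 / 2 : ℝ) < 1)
  obtain ⟨B, hB, hBA, hB0, hBn⟩ := exists_subset_toFun_pos_le_pow hP hat hA hpos n
  exact ⟨B, hB, hBA, hB0, hBn.trans_lt hn⟩

/-- Sierpiński's theorem: an atomless countably additive probability has convex range. -/
theorem exists_subset_toFun_eq (hP : IsProbCharge P) (hca : CountablyAdditive P)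
    (hat : AtomlessCharge P) {A : Set Ω} (hA : MeasurableSet A) {t : ℝ} (ht0 : 0 ≤ t)
    (htA : t ≤ P.toFun A) : ∃ D, MeasurableSet D ∧ D ⊆ A ∧ P.toFun D = t := by
  let T := {D : Set Ω // MeasurableSet D ∧ D ⊆ A ∧ P.toFun D ≤ t}
  have step : ∀ (D : T) (n : ℕ), ∃ D' : T, D.1 ⊆ D'.1 ∧
      ∀ E : T, D.1 ⊆ E.1 → P.toFun E.1 ≤ P.toFun D'.1 + 1 / ((n : ℝ) + 1) := by
    intro D n
    let X : Set ℝ := {x | ∃ E : T, D.1 ⊆ E.1 ∧ P.toFun E.1 = x}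
    have hX : BddAbove X := ⟨t, by rintro _ ⟨E, -, rfl⟩; exact E.2.2.2⟩
    have hn : (0 : ℝ) < 1 / ((n : ℝ) + 1) := by positivity
    obtain ⟨_, ⟨D', hD', rfl⟩, hlt⟩ :=
      exists_lt_of_lt_csSup (⟨_, D, subset_rfl, rfl⟩ : X.Nonempty) (sub_lt_self (sSup X) hn)
    refine ⟨D', hD', fun E hE => ?_⟩
    have := le_csSup hX ⟨E, hE, rfl⟩
    linarith
  choose next hnext hsup using step
  let D : ℕ → T := fun n => Nat.rec
    ⟨∅, MeasurableSet.empty, Set.empty_subset _, P.toFun_empty.le.trans ht0⟩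
    (fun n E => next E n) n
  have hmono : Monotone fun n => (D n).1 := monotone_nat_of_le_succ fun n => hnext (D n) n
  have hlim := tendsto_toFun_iUnion hca (fun n => (D n).2.1) hmono
  have hU : MeasurableSet (⋃ n, (D n).1) := MeasurableSet.iUnion fun n => (D n).2.1
  have hUA : (⋃ n, (D n).1) ⊆ A := Set.iUnion_subset fun n => (D n).2.2.1
  have hle : P.toFun (⋃ n, (D n).1) ≤ t := le_of_tendsto' hlim fun n => (D n).2.2.2
  refine ⟨_, hU, hUA, le_antisymm hle (le_of_not_gt fun hlt => ?_)⟩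
  have hdiff := P.toFun_diff hA hU hUA
  obtain ⟨E, hE, hEA, hE0, hEt⟩ := exists_subset_toFun_pos_lt hP hat (hA.diff hU)
    (by linarith) (sub_pos.2 hlt)
  have hadd := P.additive _ _ hU hE (Set.disjoint_sdiff_right.mono_right hEA)
  let F : T := ⟨(⋃ n, (D n).1) ∪ E, hU.union hE, Set.union_subset hUA (hEA.trans Set.sdiff_subset),
    by linarith⟩
  obtain ⟨n, hn⟩ := exists_nat_one_div_lt hE0
  have h1 := hsup (D n) n F
    ((Set.subset_iUnion (fun n => (D n).1) n).trans Set.subset_union_left)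
  have h2 : P.toFun (D (n + 1)).1 ≤ P.toFun (⋃ n, (D n).1) :=
    toFun_mono hP (D (n + 1)).2.1 hU (Set.subset_iUnion (fun n => (D n).1) (n + 1))
  change P.toFun ((⋃ n, (D n).1) ∪ E) ≤ P.toFun (D (n + 1)).1 + _ at h1
  linarith

/-- Among the subsets of `A` of given probability `t`, the values of a charge `μ` come arbitrarily
close to, or exceed, the proportional value `μ(A) / P(A) * t`. -/
theorem exists_subset_proportional_le (hP : IsProbCharge P) (hca : CountablyAdditive P)
    (hat : AtomlessCharge P) (μ : Charge (MSets Ω)) {A : Set Ω} (hA : MeasurableSet A) {t : ℝ}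
    (ht0 : 0 ≤ t) (htA : t ≤ P.toFun A) {ε : ℝ} (hε : 0 < ε) :
    ∃ D, MeasurableSet D ∧ D ⊆ A ∧ P.toFun D = t ∧
      μ.toFun A / P.toFun A * t ≤ μ.toFun D + ε := by
  rcases (hP.2 A).eq_or_lt with h0 | hpos
  · have ht : t = 0 := le_antisymm (htA.trans h0.symm.le) ht0
    subst ht
    exact ⟨∅, MeasurableSet.empty, Set.empty_subset _, P.toFun_empty,
      by rw [μ.toFun_empty]; simpa using hε.le⟩
  set c := μ.toFun A / P.toFun A with hc
  have hcA : c * P.toFun A = μ.toFun A := div_mul_cancel₀ _ hpos.ne'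
  let σ : Set Ω → ℝ := fun D => μ.toFun D - c * P.toFun D
  let X : Set ℝ := {x | ∃ H, MeasurableSet H ∧ H ⊆ A ∧ σ H = x}
  have hX : BddAbove X := by
    obtain ⟨C, hC⟩ := μ.bounded
    obtain ⟨C', hC'⟩ := (c • P).bounded
    refine ⟨C + C', ?_⟩
    rintro _ ⟨H, -, -, rfl⟩
    have h1 := (abs_le.1 (hC H)).2
    have h2 := (abs_le.1 (hC' H)).1
    rw [smul_toFun] at h2
    change μ.toFun H - c * P.toFun H ≤ _
    linarith
  obtain ⟨_, ⟨H, hH, hHA, rfl⟩, hlt⟩ := exists_lt_of_lt_csSup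
    (⟨_, A, hA, subset_rfl, rfl⟩ : X.Nonempty) (sub_lt_self (sSup X) hε)
  have hmax : ∀ E, MeasurableSet E → E ⊆ A → σ E ≤ σ H + ε := fun E hE hEA => by
    have := le_csSup hX ⟨E, hE, hEA, rfl⟩
    linarith
  simp only [σ] at hmax
  rcases le_total t (P.toFun H) with h | h
  · obtain ⟨D, hD, hDH, hDt⟩ := exists_subset_toFun_eq hP hca hat hH ht0 h
    refine ⟨D, hD, hDH.trans hHA, hDt, ?_⟩
    have := hmax (H \ D) (hH.diff hD) (Set.sdiff_subset.trans hHA)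
    rw [μ.toFun_diff hH hD hDH, P.toFun_diff hH hD hDH, hDt] at this
    linarith
  · have hAH := P.toFun_diff hA hH hHA
    obtain ⟨E, hE, hEAH, hEt⟩ := exists_subset_toFun_eq hP hca hat (hA.diff hH)
      (t := P.toFun A - t) (by linarith) (by linarith)
    have hEA : E ⊆ A := hEAH.trans Set.sdiff_subset
    refine ⟨A \ E, hA.diff hE, Set.sdiff_subset, by rw [P.toFun_diff hA hE hEA]; linarith, ?_⟩
    have := hmax (H ∪ E) (hH.union hE) (Set.union_subset hHA hEA)
    have hd := Set.disjoint_sdiff_right.mono_right hEAH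
    rw [μ.additive _ _ hH hE hd, P.additive _ _ hH hE hd, hEt] at this
    rw [μ.toFun_diff hA hE hEA]
    linarith

end ConvexRange

section TwoStep

variable {Ω : Type*} [MeasurableSpace Ω]

open Classical in
/-- The charge with density `α` on `B` and `β` off `B` with respect to `P`. -/
noncomputable def twoStep (P : Charge (MSets Ω)) (α β : ℝ) {B : Set Ω} (hB : MeasurableSet B) :
    Charge (MSets Ω) where
  toFun C := if MeasurableSet C then α * P.toFun (C ∩ B) + β * P.toFun (C \ B) else 0
  zero_of_not_mem C hC := if_neg hC
  additive C D hC hD hCD := by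
    have hC' : MeasurableSet C := hC
    have hD' : MeasurableSet D := hD
    rw [if_pos hC', if_pos hD', if_pos (hC'.union hD'), Set.union_inter_distrib_right,
      Set.union_sdiff_distrib,
      P.additive _ _ (hC'.inter hB) (hD'.inter hB) (hCD.mono Set.inter_subset_left
        Set.inter_subset_left),
      P.additive _ _ (hC'.diff hB) (hD'.diff hB) (hCD.mono Set.sdiff_subset Set.sdiff_subset)]
    ring
  bounded := by
    obtain ⟨K, hK⟩ := (α • P).bounded
    obtain ⟨L, hL⟩ := (β • P).bounded
    refine ⟨K + L, fun C => ?_⟩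
    have h1 := hK (C ∩ B)
    have h2 := hL (C \ B)
    rw [smul_toFun] at h1 h2
    split_ifs
    · exact (abs_add_le _ _).trans (add_le_add h1 h2)
    · simpa using add_nonneg ((abs_nonneg _).trans h1) ((abs_nonneg _).trans h2)

variable {P : Charge (MSets Ω)} {α β : ℝ} {A B C : Set Ω}

theorem twoStep_toFun (hB : MeasurableSet B) (hC : MeasurableSet C) :
    (P.twoStep α β hB).toFun C = α * P.toFun (C ∩ B) + β * P.toFun (C \ B) :=
  if_pos hC

theorem countablyAdditive_twoStep (hca : CountablyAdditive P) (hB : MeasurableSet B) :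
    CountablyAdditive (P.twoStep α β hB) := by
  intro f hf hd hU
  have hf' : ∀ n, MeasurableSet (f n) := hf
  have h1 := hca (fun n => f n ∩ B) (fun n => (hf' n).inter hB)
    (fun m n h => (hd h).mono Set.inter_subset_left Set.inter_subset_left)
    (MeasurableSet.iUnion fun n => (hf' n).inter hB)
  have h2 := hca (fun n => f n \ B) (fun n => (hf' n).diff hB)
    (fun m n h => (hd h).mono Set.sdiff_subset Set.sdiff_subset)
    (MeasurableSet.iUnion fun n => (hf' n).diff hB)
  rw [← Set.iUnion_inter] at h1
  rw [← Set.iUnion_sdiff] at h2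
  rw [twoStep_toFun hB hU]
  simpa only [twoStep_toFun hB (hf' _)] using (h1.mul_left α).add (h2.mul_left β)

/-- The two-step charge that spreads `μ(A)` evenly over `B` and `μ(Aᶜ)` evenly over `Bᶜ`; it is
meant for sets `A` and `B` of equal probability. -/
noncomputable def spread (P μ : Charge (MSets Ω)) (A : Set Ω) {B : Set Ω} (hB : MeasurableSet B) :
    Charge (MSets Ω) :=
  P.twoStep (μ.toFun A / P.toFun A) (μ.toFun Aᶜ / P.toFun Aᶜ) hB

theorem toFun_compl_eq (hA : MeasurableSet A) (hB : MeasurableSet B)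
    (hAB : P.toFun A = P.toFun B) : P.toFun Aᶜ = P.toFun Bᶜ := by
  linarith [P.toFun_add_compl hA, P.toFun_add_compl hB]

theorem spread_toFun_self (μ : Charge (MSets Ω)) (hB : MeasurableSet B)
    (hAB : P.toFun A = P.toFun B) (h0 : P.toFun B ≠ 0) :
    (P.spread μ A hB).toFun B = μ.toFun A := by
  rw [spread, twoStep_toFun hB hB, Set.inter_self, Set.sdiff_self, P.toFun_empty, hAB,
    div_mul_cancel₀ _ h0, mul_zero, add_zero]

theorem spread_toFun_of_eq_zero (μ : Charge (MSets Ω)) (hB : MeasurableSet B)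
    (h0 : P.toFun B = 0) : (P.spread μ A hB).toFun B = 0 := by
  rw [spread, twoStep_toFun hB hB, Set.inter_self, Set.sdiff_self, P.toFun_empty, h0]
  simp

theorem spread_univ_toFun (hP : IsProbCharge P) (μ : Charge (MSets Ω)) (hC : MeasurableSet C) :
    (P.spread μ Set.univ MeasurableSet.univ).toFun C = μ.toFun Set.univ * P.toFun C := by
  rw [spread, twoStep_toFun _ hC]
  simp [hP.1, μ.toFun_empty]

theorem spread_toFun_univ {μ : Charge (MSets Ω)} (hA : MeasurableSet A) (hB : MeasurableSet B)
    (hAB : P.toFun A = P.toFun B) (hnull : ∀ N, MeasurableSet N → P.toFun N = 0 → μ.toFun N = 0) :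
    (P.spread μ A hB).toFun Set.univ = μ.toFun Set.univ := by
  rw [spread, twoStep_toFun hB MeasurableSet.univ, Set.univ_inter, ← Set.compl_eq_univ_sdiff, ← hAB,
    ← toFun_compl_eq hA hB hAB, div_mul_cancel_of_imp (hnull A hA),
    div_mul_cancel_of_imp (hnull Aᶜ hA.compl), μ.toFun_add_compl hA]

theorem exists_spread_le (hP : IsProbCharge P) (hca : CountablyAdditive P)
    (hat : AtomlessCharge P) (μ : Charge (MSets Ω)) (hA : MeasurableSet A) (hB : MeasurableSet B)
    (hC : MeasurableSet C) (hAB : P.toFun A = P.toFun B) {ε : ℝ} (hε : 0 < ε) :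
    ∃ D, MeasurableSet D ∧ P.toFun D = P.toFun C ∧
      (P.spread μ A hB).toFun C ≤ μ.toFun D + ε := by
  obtain ⟨D₁, hD₁, hDA₁, ht₁, h₁⟩ := exists_subset_proportional_le hP hca hat μ hA
    (hP.2 (C ∩ B)) (hAB ▸ toFun_mono hP (hC.inter hB) hB Set.inter_subset_right) (half_pos hε)
  obtain ⟨D₂, hD₂, hDA₂, ht₂, h₂⟩ := exists_subset_proportional_le hP hca hat μ hA.compl
    (hP.2 (C \ B)) (toFun_compl_eq hA hB hAB ▸ toFun_mono hP (hC.diff hB) hB.compl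
      fun _ hx => hx.2) (half_pos hε)
  have hd : Disjoint D₁ D₂ := disjoint_compl_right.mono hDA₁ hDA₂
  refine ⟨D₁ ∪ D₂, hD₁.union hD₂, ?_, ?_⟩
  · rw [P.additive _ _ hD₁ hD₂ hd, ht₁, ht₂, P.toFun_inter_add_diff hC hB]
  · rw [μ.additive _ _ hD₁ hD₂ hd, spread, twoStep_toFun hB hC]
    linarith

theorem spread_neg_one_smul (μ : Charge (MSets Ω)) (hB : MeasurableSet B)
    (hC : MeasurableSet C) :
    (P.spread ((-1 : ℝ) • μ) A hB).toFun C = -(P.spread μ A hB).toFun C := by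
  simp only [spread, twoStep_toFun hB hC, smul_toFun]
  ring

theorem exists_le_spread (hP : IsProbCharge P) (hca : CountablyAdditive P)
    (hat : AtomlessCharge P) (μ : Charge (MSets Ω)) (hA : MeasurableSet A) (hB : MeasurableSet B)
    (hC : MeasurableSet C) (hAB : P.toFun A = P.toFun B) {ε : ℝ} (hε : 0 < ε) :
    ∃ D, MeasurableSet D ∧ P.toFun D = P.toFun C ∧
      μ.toFun D ≤ (P.spread μ A hB).toFun C + ε := by
  obtain ⟨D, hD, hDC, h⟩ := exists_spread_le hP hca hat ((-1 : ℝ) • μ) hA hB hC hAB hε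
  refine ⟨D, hD, hDC, ?_⟩
  rw [spread_neg_one_smul μ hB hC, smul_toFun] at h
  linarith

end TwoStep

end Charge

section Transfer

open Charge

variable {Ω : Type*} [MeasurableSpace Ω] {P : Charge (MSets Ω)}

/-- A set of charges closed under spreading, all of whose members are nonpositive on `P`-null sets,
has the sup-transfer property. -/
theorem supTransfer_of_spread_mem (hP : IsProbCharge P) (hca : CountablyAdditive P)
    (hat : AtomlessCharge P) {Y : Set (Charge (MSets Ω))}
    (hspread : ∀ μ ∈ Y, ∀ A B : Set Ω, MeasurableSet A → ∀ hB : MeasurableSet B,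
      P.toFun A = P.toFun B → P.spread μ A hB ∈ Y)
    (hnull : ∀ μ ∈ Y, ∀ N : Set Ω, MeasurableSet N → P.toFun N = 0 → μ.toFun N ≤ 0) :
    SupTransfer Y P := by
  have key : ∀ u : Charge (MSets Ω), (∀ ν ∈ Y, CountablyAdditive ν → ν ≤ u) →
      ∀ μ ∈ Y, ∀ A B : Set Ω, MeasurableSet A → MeasurableSet B → P.toFun A = P.toFun B →
      μ.toFun A ≤ u.toFun B := by
    intro u hu μ hμ A B hA hB hAB
    have h := hu _ (hspread μ hμ A B hA hB hAB) (countablyAdditive_twoStep hca hB) B hB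
    by_cases h0 : P.toFun B = 0
    · rw [spread_toFun_of_eq_zero μ hB h0] at h
      exact (hnull μ hμ A hA (hAB.trans h0)).trans h
    · rwa [spread_toFun_self μ hB hAB h0] at h
  have ub_of_ub : ∀ u : Charge (MSets Ω), (∀ ν ∈ Y, CountablyAdditive ν → ν ≤ u) →
      u ∈ upperBounds Y := fun u hu μ hμ A hA => key u hu μ hμ A A hA hA rfl
  have ub_spread : ∀ u ∈ upperBounds Y, ∀ (A : Set Ω) (hA : MeasurableSet A),
      P.spread u A hA ∈ upperBounds Y := by
    intro u hu A hA μ hμ C hC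
    refine le_of_forall_pos_le_add fun ε hε => ?_
    obtain ⟨D, hD, hDC, h⟩ := exists_le_spread hP hca hat u hA hA hC rfl hε
    exact (key u (fun ν hν _ => hu hν) μ hμ C D hC hD hDC.symm).trans h
  have eq_smul : ∀ s : Charge (MSets Ω), IsLUB Y s → s = s.toFun Set.univ • P := by
    intro s hs
    have hle := hs.2 (ub_spread s hs.1 Set.univ MeasurableSet.univ)
    refine le_antisymm (fun A hA => ?_) fun A hA => ?_
    · have := hle A hA
      rwa [spread_univ_toFun hP s hA] at this
    · have hAc : MeasurableSet Aᶜ := MeasurableSet.compl hA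
      have h1 := hle Aᶜ hAc
      rw [spread_univ_toFun hP s hAc] at h1
      have h2 := P.toFun_add_compl hA
      rw [hP.1] at h2
      have h3 := s.toFun_add_compl hA
      rw [smul_toFun]
      have h4 : P.toFun Aᶜ = 1 - P.toFun A := by linarith
      rw [h4] at h1
      linarith
  have toSigma : ∀ s : Charge (MSets Ω), IsLUB Y s → ∀ hs : CountablyAdditive s,
      IsLUB {ν : {μ : Charge (MSets Ω) // CountablyAdditive μ} | ν.1 ∈ Y} ⟨s, hs⟩ :=
    fun s hs _ => ⟨fun ν hν => hs.1 hν,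
      fun u hu => hs.2 (ub_of_ub u.1 fun ν hν hν' => hu (a := ⟨ν, hν'⟩) hν)⟩
  have ca_of_lub : ∀ s : Charge (MSets Ω), IsLUB Y s → CountablyAdditive s := fun s hs => by
    rw [eq_smul s hs]
    exact hca.smul _
  refine ⟨⟨fun ⟨s, hs⟩ => ⟨_, toSigma s hs (ca_of_lub s hs)⟩, ?_⟩,
    fun s hs => ⟨_, eq_smul s hs, ca_of_lub s hs, toSigma s hs _⟩⟩
  rintro ⟨⟨s, hsca⟩, hs⟩
  have least : ∀ u : Charge (MSets Ω), CountablyAdditive u → u ∈ upperBounds Y → s ≤ u :=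
    fun u huca hu => hs.2 (show (⟨u, huca⟩ : {μ : Charge (MSets Ω) // CountablyAdditive μ}) ∈
      upperBounds {ν | ν.1 ∈ Y} from fun ν hν => hu hν)
  have hne : Y.Nonempty := by
    by_contra hY
    rw [Set.not_nonempty_iff_eq_empty] at hY
    have h : s ≤ (s.toFun Set.univ - 1) • P :=
      least _ (hca.smul _) (by simp [hY])
    have := h Set.univ MeasurableSet.univ
    rw [smul_toFun, hP.1] at this
    linarith
  obtain ⟨μ, hμ⟩ := hne
  refine ⟨s, ub_of_ub s fun ν hν hν' =>
    hs.1 (show ⟨ν, hν'⟩ ∈ {ν : {μ : Charge (MSets Ω) // CountablyAdditive μ} | ν.1 ∈ Y} from hν),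
    fun u hu A hA => ?_⟩
  have hle : s ≤ P.spread u A hA :=
    least _ (countablyAdditive_twoStep hca hA) (ub_spread u hu A hA)
  have h := hle A hA
  by_cases h0 : P.toFun A = 0
  · rw [spread_toFun_of_eq_zero u hA h0] at h
    have := key u (fun ν hν _ => hu hν) μ hμ ∅ A MeasurableSet.empty hA (by rw [P.toFun_empty, h0])
    rw [μ.toFun_empty] at this
    exact h.trans this
  · rwa [spread_toFun_self u hA rfl h0] at h

theorem isLUB_preimage_iff_isGLB_of_antitone {α : Type*} [Preorder α] {n : α → α}
    (hn : Antitone n) (hinv : Function.Involutive n) {Y : Set α} {s : α} :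
    IsLUB (n ⁻¹' Y) (n s) ↔ IsGLB Y s := by
  have hle : ∀ {x y : α}, n x ≤ n y ↔ y ≤ x :=
    ⟨fun h => by simpa only [hinv _] using hn h, fun h => hn h⟩
  have hmem : ∀ {u : α}, n u ∈ upperBounds (n ⁻¹' Y) ↔ u ∈ lowerBounds Y :=
    ⟨fun h x hx => hle.1 (h (by rwa [Set.mem_preimage, hinv])),
      fun h x hx => by simpa only [hinv _] using hn (h hx)⟩
  refine ⟨fun h => ⟨hmem.1 h.1, fun u hu => hle.1 (h.2 (hmem.2 hu))⟩,
    fun h => ⟨hmem.2 h.1, fun u hu => ?_⟩⟩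
  rw [← hinv u] at hu ⊢
  exact hle.2 (h.2 (hmem.1 hu))

theorem SupTransfer.infTransfer {Y : Set (Charge (MSets Ω))}
    (h : SupTransfer ((fun μ : Charge (MSets Ω) => (-1 : ℝ) • μ) ⁻¹' Y) P) :
    InfTransfer Y P := by
  have hinv : Function.Involutive fun μ : Charge (MSets Ω) => (-1 : ℝ) • μ :=
    neg_one_smul_neg_one_smul
  let n : {μ : Charge (MSets Ω) // CountablyAdditive μ} →
      {μ : Charge (MSets Ω) // CountablyAdditive μ} := fun μ => ⟨(-1 : ℝ) • μ.1, μ.2.smul _⟩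
  have hninv : Function.Involutive n := fun μ => Subtype.ext (neg_one_smul_neg_one_smul μ.1)
  have hn : Antitone n := fun μ ν hμν => neg_one_smul_antitone hμν
  have e1 : ∀ s : Charge (MSets Ω), _ ↔ IsGLB Y s := fun s =>
    isLUB_preimage_iff_isGLB_of_antitone neg_one_smul_antitone hinv
  have e2 : ∀ s, _ ↔ IsGLB {ν : {μ : Charge (MSets Ω) // CountablyAdditive μ} | ν.1 ∈ Y} s :=
    fun s => isLUB_preimage_iff_isGLB_of_antitone hn hninv
  refine ⟨?_, fun s hs => ?_⟩
  · exact ((exists_congr fun s => (e1 s).symm).trans hinv.surjective.exists.symm).trans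
      (h.1.trans (hninv.surjective.exists.trans (exists_congr e2)))
  · obtain ⟨a, ha, hca, hlub⟩ := h.2 _ ((e1 s).2 hs)
    have hs' : s = (-1 : ℝ) • (-1 : ℝ) • s := (neg_one_smul_neg_one_smul s).symm
    have hsca : CountablyAdditive s := by
      rw [hs']
      exact CountablyAdditive.smul hca _
    refine ⟨-a, ?_, hsca, (e2 ⟨s, hsca⟩).1 hlub⟩
    rw [hs']
    rw [ha]
    exact ext' (funext fun A => by simp)

variable {v : Set Ω → ℝ}

theorem toFun_nonpos_of_mem_looseAnticore (hv0 : v ∅ = 0)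
    (hvinv : ∀ A ∈ MSets Ω, ∀ B ∈ MSets Ω, P.toFun A = P.toFun B → v A = v B)
    {μ : Charge (MSets Ω)} (hμ : μ ∈ LooseAnticore v) {N : Set Ω} (hN : MeasurableSet N)
    (h0 : P.toFun N = 0) : μ.toFun N ≤ 0 := by
  rw [← hv0, ← hvinv N hN ∅ MeasurableSet.empty (by rw [h0, P.toFun_empty])]
  exact hμ N hN

theorem toFun_eq_zero_of_mem_anticore (hv0 : v ∅ = 0)
    (hvinv : ∀ A ∈ MSets Ω, ∀ B ∈ MSets Ω, P.toFun A = P.toFun B → v A = v B)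
    {μ : Charge (MSets Ω)} (hμ : μ ∈ Anticore v) {N : Set Ω} (hN : MeasurableSet N)
    (h0 : P.toFun N = 0) : μ.toFun N = 0 := by
  refine le_antisymm (toFun_nonpos_of_mem_looseAnticore hv0 hvinv hμ.1 hN h0) ?_
  have h1 := hμ.1 Nᶜ hN.compl
  rw [hvinv Nᶜ hN.compl Set.univ MeasurableSet.univ (by linarith [P.toFun_add_compl hN]),
    ← hμ.2] at h1
  linarith [μ.toFun_add_compl hN]

theorem spread_mem_looseAnticore (hP : IsProbCharge P) (hca : CountablyAdditive P)
    (hat : AtomlessCharge P)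
    (hvinv : ∀ A ∈ MSets Ω, ∀ B ∈ MSets Ω, P.toFun A = P.toFun B → v A = v B)
    {μ : Charge (MSets Ω)} (hμ : μ ∈ LooseAnticore v) {A B : Set Ω} (hA : MeasurableSet A)
    (hB : MeasurableSet B) (hAB : P.toFun A = P.toFun B) :
    P.spread μ A hB ∈ LooseAnticore v := by
  intro C hC
  refine le_of_forall_pos_le_add fun ε hε => ?_
  obtain ⟨D, hD, hDC, h⟩ := exists_spread_le hP hca hat μ hA hB hC hAB hε
  rw [← hvinv D hD C hC hDC]
  linarith [hμ D hD]

theorem supTransfer_looseAnticore (hP : IsProbCharge P) (hca : CountablyAdditive P)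
    (hat : AtomlessCharge P) (hv0 : v ∅ = 0)
    (hvinv : ∀ A ∈ MSets Ω, ∀ B ∈ MSets Ω, P.toFun A = P.toFun B → v A = v B) :
    SupTransfer (LooseAnticore v) P :=
  supTransfer_of_spread_mem hP hca hat
    (fun _ hμ _ _ hA hB hAB => spread_mem_looseAnticore hP hca hat hvinv hμ hA hB hAB)
    fun _ hμ _ hN h0 => toFun_nonpos_of_mem_looseAnticore hv0 hvinv hμ hN h0

theorem supTransfer_anticore (hP : IsProbCharge P) (hca : CountablyAdditive P)
    (hat : AtomlessCharge P) (hv0 : v ∅ = 0)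
    (hvinv : ∀ A ∈ MSets Ω, ∀ B ∈ MSets Ω, P.toFun A = P.toFun B → v A = v B) :
    SupTransfer (Anticore v) P :=
  supTransfer_of_spread_mem hP hca hat
    (fun _ hμ _ _ hA hB hAB => ⟨spread_mem_looseAnticore hP hca hat hvinv hμ.1 hA hB hAB,
      (spread_toFun_univ hA hB hAB fun _ hN h0 =>
        toFun_eq_zero_of_mem_anticore hv0 hvinv hμ hN h0).trans hμ.2⟩)
    fun _ hμ _ hN h0 => (toFun_eq_zero_of_mem_anticore hv0 hvinv hμ hN h0).le

theorem neg_one_smul_preimage_looseCore :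
    (fun μ : Charge (MSets Ω) => (-1 : ℝ) • μ) ⁻¹' LooseCore v = LooseAnticore (-v) := by
  ext μ
  refine forall₂_congr fun A _ => ?_
  rw [smul_toFun, neg_one_mul, Pi.neg_apply]
  exact le_neg

theorem neg_one_smul_preimage_core :
    (fun μ : Charge (MSets Ω) => (-1 : ℝ) • μ) ⁻¹' Core v = Anticore (-v) := by
  ext μ
  refine and_congr (Set.ext_iff.1 neg_one_smul_preimage_looseCore μ) ?_
  rw [smul_toFun, neg_one_mul, Pi.neg_apply]
  exact neg_eq_iff_eq_neg

end Transfer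

/-- Let `P` be an atomless countably additive probability charge on a
σ-algebra and `v` a `P`-invariant game. For the anticore and loose anticore, the supremum
exists in `ba` iff the supremum of the corresponding σ-version exists in `ca`, in which case
both equal a scalar multiple of `P`; dually for the core and loose core with infima. -/
theorem stmt5 {Ω : Type*} [MeasurableSpace Ω]
    (P : Charge (MSets Ω)) (hPca : CountablyAdditive P) (hPprob : IsProbCharge P)
    (hPatomless : AtomlessCharge P)
    (v : Set Ω → ℝ) (hv0 : v ∅ = 0)
    (hvinv : ∀ A ∈ MSets Ω, ∀ B ∈ MSets Ω, P.toFun A = P.toFun B → v A = v B) :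
    SupTransfer (Anticore v) P ∧ SupTransfer (LooseAnticore v) P ∧
    InfTransfer (Core v) P ∧ InfTransfer (LooseCore v) P := by
  have hv0' : (-v) ∅ = 0 := by rw [Pi.neg_apply, hv0, neg_zero]
  have hvinv' : ∀ A ∈ MSets Ω, ∀ B ∈ MSets Ω, P.toFun A = P.toFun B → (-v) A = (-v) B :=
    fun A hA B hB h => congrArg Neg.neg (hvinv A hA B hB h)
  refine ⟨supTransfer_anticore hPprob hPca hPatomless hv0 hvinv,
    supTransfer_looseAnticore hPprob hPca hPatomless hv0 hvinv,
    SupTransfer.infTransfer ?_, SupTransfer.infTransfer ?_⟩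
  · rw [neg_one_smul_preimage_core]
    exact supTransfer_anticore hPprob hPca hPatomless hv0' hvinv'
  · rw [neg_one_smul_preimage_looseCore]
    exact supTransfer_looseAnticore hPprob hPca hPatomless hv0' hvinv'
end
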